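/- Let k̄ be odd with 3 ≤ k̄ ≤ L/2 and let Q = Σ_{A∈P_Λ, Diag A ≤ k̄} q_A A satisfy [H,Q] = 0. Then q_{C^{k̄}_j} = 0 for every base site u_1 and every j; consequently, q_A = 0 for every Pauli product A with Diag A = k̄, and there is no local conserved quantity of H with diagonal length k̄. -/

import Mathlib

open Complex Matrix

/-- Sites of the `L × L` square lattice with periodic boundary conditions. -/
abbrev Site (L : ℕ) := ZMod L × ZMod L

/-- A specification of a product of Pauli matrices: at each site either
`0` (no operator), `1` (`X`), `2` (`Y`) or `3` (`Z`). -/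
abbrev PSpec (L : ℕ) := Site L → Fin 4

/-- Operators on the Hilbert space `⊗_{u ∈ Λ} ℂ²`. -/
abbrev Op (L : ℕ) := Matrix (Site L → Fin 2) (Site L → Fin 2) ℂ

/-- The Pauli matrices (`0` gives the identity). -/
noncomputable def pauli (w : Fin 4) : Matrix (Fin 2) (Fin 2) ℂ :=
  if w = 1 then !![0, 1; 1, 0]
  else if w = 2 then !![0, -Complex.I; Complex.I, 0]
  else if w = 3 then !![1, 0; 0, -1]
  else 1

/-- The product of Pauli matrices specified by `σ`, as an operator (matrix)
on the full Hilbert space. -/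
noncomputable def PauliOp (L : ℕ) [NeZero L] (σ : PSpec L) : Op L :=
  fun s t => ∏ u : Site L, pauli (σ u) (s u) (t u)

/-- `DiagBoundAt L σ a k` : every site `u` in the support of `σ` satisfies
`0 ≤ uₓ + u_y − a ≤ k − 1 (mod L)`. -/
def DiagBoundAt (L : ℕ) (σ : PSpec L) (a : ZMod L) (k : ℕ) : Prop :=
  ∀ u : Site L, σ u ≠ 0 → (u.1 + u.2 - a).val < k

/-- The diagonal length of a Pauli product. -/
noncomputable def Diag (L : ℕ) (σ : PSpec L) : ℕ :=
  sInf {k | ∃ a : ZMod L, DiagBoundAt L σ a k}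

/-- `X_u` as a Pauli-product specification. -/
def sigX (L : ℕ) (u : Site L) : PSpec L := fun v => if v = u then 1 else 0
/-- `Y_u` as a Pauli-product specification. -/
def sigY (L : ℕ) (u : Site L) : PSpec L := fun v => if v = u then 2 else 0
/-- `Z_u` as a Pauli-product specification. -/
def sigZ (L : ℕ) (u : Site L) : PSpec L := fun v => if v = u then 3 else 0
/-- A single-site Pauli operator `W_u` (`w ∈ {1,2,3}`). -/
def sigW (L : ℕ) (u : Site L) (w : Fin 4) : PSpec L := fun v => if v = u then w else 0

/-- `X_u X_{u+eₓ}` as a Pauli-product specification. -/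
def sigXX (L : ℕ) (u : Site L) : PSpec L :=
  fun v => if v = u then 1 else if v = u + (1, 0) then 1 else 0
/-- `Y_u Y_{u+e_y}` as a Pauli-product specification. -/
def sigYY (L : ℕ) (u : Site L) : PSpec L :=
  fun v => if v = u then 2 else if v = u + (0, 1) then 2 else 0

/-- The quantum compass Hamiltonian
`H = −Σ_u (Jx X_u X_{u+eₓ} + Jy Y_u Y_{u+e_y})`. -/
noncomputable def Hcompass (L : ℕ) [NeZero L] (Jx Jy : ℝ) : Op L :=
  - ∑ u : Site L, ((Jx : ℂ) • PauliOp L (sigXX L u) + (Jy : ℂ) • PauliOp L (sigYY L u))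

/-- The quantum compass Hamiltonian with a uniform magnetic field. -/
noncomputable def Hfield (L : ℕ) [NeZero L] (Jx Jy hx hy hz : ℝ) : Op L :=
  - ∑ u : Site L,
      ((Jx : ℂ) • PauliOp L (sigXX L u) + (Jy : ℂ) • PauliOp L (sigYY L u)
        + (hx : ℂ) • PauliOp L (sigX L u) + (hy : ℂ) • PauliOp L (sigY L u)
        + (hz : ℂ) • PauliOp L (sigZ L u))

/-- The candidate conserved quantity `Q = Σ_σ q_σ σ`. -/
noncomputable def Qop (L : ℕ) [NeZero L] (q : PSpec L → ℂ) : Op L :=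
  ∑ σ : PSpec L, q σ • PauliOp L σ

/-- Commutator of operators. -/
noncomputable def opComm (L : ℕ) [NeZero L] (A B : Op L) : Op L := A * B - B * A

/-- The coefficient `λ_{σ,τ}` of the Pauli product `τ` in the expansion
`[H, σ] = Σ_τ λ_{σ,τ} τ`, extracted via the (normalized) trace inner product. -/
noncomputable def lam (L : ℕ) [NeZero L] (H : Op L) (σ τ : PSpec L) : ℂ :=
  Matrix.trace (PauliOp L τ * opComm L H (PauliOp L σ)) / (2 ^ Fintype.card (Site L))

/-- `u` is a top-right site of `σ` (relative to the witness `a` for diagonal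
length `k`). -/
def IsTopRight (L : ℕ) (σ : PSpec L) (a : ZMod L) (k : ℕ) (u : Site L) : Prop :=
  σ u ≠ 0 ∧ (u.1 + u.2 - a).val = k - 1

/-- `u` is a bottom-left site of `σ` (relative to the witness `a`). -/
def IsBottomLeft (L : ℕ) (σ : PSpec L) (a : ZMod L) (u : Site L) : Prop :=
  σ u ≠ 0 ∧ (u.1 + u.2 - a).val = 0

/-- Condition (1): `σ` has a unique top-right site `ū`, with
(1a) `σ_ū = X` and `ū − eₓ ∈ Supp σ`, or (1b) `σ_ū = Y` and `ū − e_y ∈ Supp σ`. -/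
def Cond1 (L : ℕ) (σ : PSpec L) (a : ZMod L) (k : ℕ) : Prop :=
  ∃ ub : Site L, (∀ v : Site L, IsTopRight L σ a k v ↔ v = ub) ∧
    ((σ ub = 1 ∧ σ (ub - (1, 0)) ≠ 0) ∨ (σ ub = 2 ∧ σ (ub - (0, 1)) ≠ 0))

/-- Condition (2): `σ` has a unique bottom-left site `u̲`, with
(2a) `σ_u̲ = X` and `u̲ + eₓ ∈ Supp σ`, or (2b) `σ_u̲ = Y` and `u̲ + e_y ∈ Supp σ`. -/
def Cond2 (L : ℕ) (σ : PSpec L) (a : ZMod L) : Prop :=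
  ∃ lb : Site L, (∀ v : Site L, IsBottomLeft L σ a v ↔ v = lb) ∧
    ((σ lb = 1 ∧ σ (lb + (1, 0)) ≠ 0) ∨ (σ lb = 2 ∧ σ (lb + (0, 1)) ≠ 0))

/-- `ShiftRel L k σ σ'` : `σ` has diagonal length `k`, satisfies conditions (1)
and (2), and `σ'` is the Shiraishi shift `S(σ)`, obtained by first appending a
site at the top right (the product `B`) and then truncating the bottom-left site. -/
def ShiftRel (L : ℕ) [NeZero L] (k : ℕ) (σ σ' : PSpec L) : Prop :=
  Diag L σ = k ∧ σ' ≠ 0 ∧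
  ∃ a : ZMod L, DiagBoundAt L σ a k ∧
  ∃ ub lb : Site L,
    (∀ v : Site L, IsTopRight L σ a k v ↔ v = ub) ∧
    (∀ v : Site L, IsBottomLeft L σ a v ↔ v = lb) ∧
    ∃ B : Op L,
      ((σ ub = 1 ∧ σ (ub - (1, 0)) ≠ 0 ∧
          B = (-(1 / (2 * Complex.I))) • opComm L (PauliOp L (sigYY L ub)) (PauliOp L σ)) ∨
       (σ ub = 2 ∧ σ (ub - (0, 1)) ≠ 0 ∧
          B = (1 / (2 * Complex.I)) • opComm L (PauliOp L (sigXX L ub)) (PauliOp L σ))) ∧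
      ∃ ε : ℂ, (ε = 1 / (2 * Complex.I) ∨ ε = -(1 / (2 * Complex.I))) ∧
        ((σ lb = 1 ∧ σ (lb + (1, 0)) ≠ 0 ∧
            PauliOp L σ' = ε • opComm L (PauliOp L (sigXX L lb)) B) ∨
         (σ lb = 2 ∧ σ (lb + (0, 1)) ≠ 0 ∧
            PauliOp L σ' = ε • opComm L (PauliOp L (sigYY L lb)) B))

/-- The staircase sequence `u_j`: `u_j = u₁ + ((j−1)/2)(eₓ+e_y)` for odd `j`,
and `u_j = u₁ + (j/2)(eₓ+e_y) − e_y` for even `j`. -/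
def stair (L : ℕ) (u1 : Site L) (j : ℕ) : Site L :=
  if j % 2 = 1 then
    u1 + ((((j - 1) / 2 : ℕ) : ZMod L), (((j - 1) / 2 : ℕ) : ZMod L))
  else
    u1 + (((j / 2 : ℕ) : ZMod L), ((j / 2 : ℕ) : ZMod L)) - ((0 : ZMod L), (1 : ZMod L))

/-- The Pauli letter at the first (bottom-left) end of `C^k_j`. -/
def endL (j : ℕ) : Fin 4 := if j % 2 = 1 then 1 else 2

/-- The Pauli letter at the last (top-right) end of `C^k_j`. -/
def endR (k j : ℕ) : Fin 4 :=
  if k % 2 = 1 then (if j % 2 = 1 then 2 else 1)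
  else (if j % 2 = 1 then 1 else 2)

/-- The standard-form product `C^k_j` based at `u₁`: the appropriate end
letters at `u_j` and `u_{j+k−1}`, and `Z` at `u_{j+1}, …, u_{j+k−2}`. -/
def Cspec (L : ℕ) (k j : ℕ) (u1 : Site L) : PSpec L := fun v =>
  if v = stair L u1 j then endL j
  else if v = stair L u1 (j + k - 1) then endR k j
  else if v ∈ (Finset.Icc (j + 1) (j + k - 2)).image (stair L u1) then 3
  else 0

section TensorProducts

variable {ι : Type*} [Fintype ι]

/-- The tensor product of a family of `2 × 2` matrices. -/
def tensorOp (f : ι → Matrix (Fin 2) (Fin 2) ℂ) : Matrix (ι → Fin 2) (ι → Fin 2) ℂ :=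
  fun s t => ∏ u, f u (s u) (t u)

theorem tensorOp_mul [DecidableEq ι] (f g : ι → Matrix (Fin 2) (Fin 2) ℂ) :
    tensorOp f * tensorOp g = tensorOp (fun u => f u * g u) := by
  ext s t
  simp only [tensorOp, Matrix.mul_apply, ← Finset.prod_mul_distrib]
  rw [Finset.prod_univ_sum, Fintype.piFinset_univ]

theorem trace_tensorOp [DecidableEq ι] (f : ι → Matrix (Fin 2) (Fin 2) ℂ) :
    Matrix.trace (tensorOp f) = ∏ u, Matrix.trace (f u) := by
  simp only [Matrix.trace, Matrix.diag, tensorOp]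
  rw [Finset.prod_univ_sum, Fintype.piFinset_univ]

theorem tensorOp_smul (c : ι → ℂ) (f : ι → Matrix (Fin 2) (Fin 2) ℂ) :
    tensorOp (fun u => c u • f u) = (∏ u, c u) • tensorOp f := by
  ext s t
  simp [tensorOp, Finset.prod_mul_distrib]

end TensorProducts

theorem pauli_mul (a b : Fin 4) : ∃ c : ℂ, c ≠ 0 ∧ pauli a * pauli b = c • pauli (a ^^^ b) := by
  fin_cases a <;> fin_cases b <;>
    first
    | (refine ⟨1, one_ne_zero, ?_⟩
       ext i j; fin_cases i <;> fin_cases j <;> simp [pauli]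
       done)
    | (refine ⟨I, I_ne_zero, ?_⟩
       ext i j; fin_cases i <;> fin_cases j <;> simp [pauli]
       done)
    | (refine ⟨-I, neg_ne_zero.2 I_ne_zero, ?_⟩
       ext i j; fin_cases i <;> fin_cases j <;> simp [pauli])

theorem pauli_mul_self (a : Fin 4) : pauli a * pauli a = 1 := by
  fin_cases a <;> ext i j <;> fin_cases i <;> fin_cases j <;> simp [pauli]

theorem trace_pauli (a : Fin 4) : Matrix.trace (pauli a) = if a = 0 then 2 else 0 := by
  fin_cases a <;> simp [pauli, Matrix.trace]

/-- Two Pauli letters anticommute. -/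
def letterAnti (a b : Fin 4) : Bool := a != 0 && b != 0 && a != b

theorem pauli_comm (a b : Fin 4) :
    pauli a * pauli b = (if letterAnti a b then (-1 : ℂ) else 1) • (pauli b * pauli a) := by
  fin_cases a <;> fin_cases b <;> ext i j <;> fin_cases i <;> fin_cases j <;>
    simp [pauli, letterAnti]

/-- The specification of a product of two Pauli products, up to a phase. -/
def mulSpec {L : ℕ} (σ τ : PSpec L) : PSpec L := fun v => σ v ^^^ τ v

theorem PauliOp_eq_tensorOp (L : ℕ) [NeZero L] (σ : PSpec L) :
    PauliOp L σ = tensorOp (fun u => pauli (σ u)) := rfl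

theorem PauliOp_mul (L : ℕ) [NeZero L] (σ τ : PSpec L) :
    ∃ c : ℂ, c ≠ 0 ∧ PauliOp L σ * PauliOp L τ = c • PauliOp L (mulSpec σ τ) := by
  choose c hc h using pauli_mul
  refine ⟨∏ u, c (σ u) (τ u), Finset.prod_ne_zero_iff.2 fun u _ => hc _ _, ?_⟩
  simp only [PauliOp_eq_tensorOp, tensorOp_mul, h, tensorOp_smul, mulSpec]

theorem PauliOp_zero (L : ℕ) [NeZero L] : PauliOp L 0 = 1 := by
  ext s t
  simp [PauliOp, pauli, Matrix.one_apply, Finset.prod_ite_zero, funext_iff]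

theorem PauliOp_mul_self (L : ℕ) [NeZero L] (σ : PSpec L) : PauliOp L σ * PauliOp L σ = 1 := by
  rw [PauliOp_eq_tensorOp, tensorOp_mul, ← PauliOp_zero, PauliOp_eq_tensorOp]
  simp only [pauli_mul_self]
  simp [pauli]

theorem PauliOp_comm (L : ℕ) [NeZero L] (σ τ : PSpec L) :
    PauliOp L σ * PauliOp L τ =
      (∏ u, if letterAnti (σ u) (τ u) then (-1 : ℂ) else 1) • (PauliOp L τ * PauliOp L σ) := by
  simp only [PauliOp_eq_tensorOp, tensorOp_mul]
  rw [← tensorOp_smul]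
  simp only [← pauli_comm]

theorem trace_PauliOp (L : ℕ) [NeZero L] (σ : PSpec L) (hσ : σ ≠ 0) :
    Matrix.trace (PauliOp L σ) = 0 := by
  obtain ⟨u, hu⟩ := Function.ne_iff.1 hσ
  rw [PauliOp_eq_tensorOp, trace_tensorOp]
  refine Finset.prod_eq_zero (Finset.mem_univ u) ?_
  rw [trace_pauli]
  exact if_neg hu

theorem letter_xor_eq_zero (a b : Fin 4) : a ^^^ b = 0 ↔ a = b := by revert a b; decide
theorem letter_zero_xor (a : Fin 4) : 0 ^^^ a = a := by revert a; decide
theorem letter_xor_zero (a : Fin 4) : a ^^^ 0 = a := by revert a; decide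
theorem letter_xor_cancel_left (a b : Fin 4) : a ^^^ (a ^^^ b) = b := by revert a b; decide

theorem mulSpec_cancel_left {L : ℕ} (σ τ : PSpec L) : mulSpec σ (mulSpec σ τ) = τ := by
  funext v; exact letter_xor_cancel_left _ _

theorem trace_PauliOp_mul (L : ℕ) [NeZero L] (σ τ : PSpec L) (h : σ ≠ τ) :
    Matrix.trace (PauliOp L σ * PauliOp L τ) = 0 := by
  obtain ⟨c, -, hc⟩ := PauliOp_mul L σ τ
  rw [hc, Matrix.trace_smul, trace_PauliOp, smul_zero]
  intro h0
  exact h (funext fun v => (letter_xor_eq_zero _ _).1 (congrFun h0 v))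

/-- The trace pairing with `Q = Σ_σ q_σ σ`. -/
noncomputable def pairing (L : ℕ) [NeZero L] (q : PSpec L → ℂ) (M : Op L) : ℂ :=
  Matrix.trace (Qop L q * M)

section Pairing

variable (L : ℕ) [NeZero L] (q : PSpec L → ℂ)

theorem pairing_sub (M N : Op L) : pairing L q (M - N) = pairing L q M - pairing L q N := by
  simp [pairing, mul_sub]

theorem pairing_smul (c : ℂ) (M : Op L) : pairing L q (c • M) = c * pairing L q M := by
  simp [pairing]

theorem pairing_PauliOp (σ : PSpec L) :
    pairing L q (PauliOp L σ) = 2 ^ Fintype.card (Site L) * q σ := by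
  rw [pairing, Qop, Finset.sum_mul, Matrix.trace_sum, Finset.sum_eq_single σ]
  · rw [smul_mul_assoc, PauliOp_mul_self, Matrix.trace_smul, Matrix.trace_one]
    simp [mul_comm]
  · intro τ _ hτ
    rw [smul_mul_assoc, Matrix.trace_smul, trace_PauliOp_mul L τ σ hτ, smul_zero]
  · simp

/-- `M` is a nonzero multiple of the Pauli product `σ`. -/
def IsPauli {L : ℕ} [NeZero L] (M : Op L) (σ : PSpec L) : Prop :=
  ∃ c : ℂ, c ≠ 0 ∧ M = c • PauliOp L σ

variable {L}

theorem isPauli_PauliOp (σ : PSpec L) : IsPauli (PauliOp L σ) σ := ⟨1, one_ne_zero, by simp⟩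

theorem isPauli_one : IsPauli (1 : Op L) 0 := ⟨1, one_ne_zero, by simp [PauliOp_zero]⟩

theorem IsPauli.mul {M N : Op L} {σ τ : PSpec L} (hM : IsPauli M σ) (hN : IsPauli N τ) :
    IsPauli (M * N) (mulSpec σ τ) := by
  obtain ⟨c, hc, rfl⟩ := hM
  obtain ⟨d, hd, rfl⟩ := hN
  obtain ⟨e, he, h⟩ := PauliOp_mul L σ τ
  exact ⟨c * d * e, by positivity, by rw [smul_mul_smul_comm, h, smul_smul]⟩

theorem IsPauli.pairing_eq_zero_iff {q : PSpec L → ℂ} {M : Op L} {σ : PSpec L}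
    (hM : IsPauli M σ) : pairing L q M = 0 ↔ q σ = 0 := by
  obtain ⟨c, hc, rfl⟩ := hM
  simp [pairing_smul, pairing_PauliOp, hc]

end Pairing

/-- A bond of the lattice: the lower-left site, and the type of the bond
(`true` for `XX` along `eₓ`, `false` for `YY` along `e_y`). -/
abbrev Bond (L : ℕ) := Site L × Bool

/-- The direction of a bond. -/
def dir (L : ℕ) (b : Bool) : Site L := if b then (1, 0) else (0, 1)

/-- The Pauli letter of a bond. -/
def ltr (b : Bool) : Fin 4 := if b then 1 else 2

/-- The Pauli product of a bond. -/
def bondSpec {L : ℕ} (e : Bond L) : PSpec L :=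
  fun v => if v = e.1 then ltr e.2 else if v = e.1 + dir L e.2 then ltr e.2 else 0

/-- The operator of a bond. -/
noncomputable def bondOp {L : ℕ} [NeZero L] (e : Bond L) : Op L := PauliOp L (bondSpec e)

/-- The coupling constant of a bond. -/
noncomputable def coup (Jx Jy : ℝ) (b : Bool) : ℂ := if b then Jx else Jy

/-- The bond `e` anticommutes with `τ`. -/
def BondAnti {L : ℕ} (e : Bond L) (τ : PSpec L) : Prop :=
  letterAnti (ltr e.2) (τ e.1) ≠ letterAnti (ltr e.2) (τ (e.1 + dir L e.2))

theorem Hcompass_eq (L : ℕ) [NeZero L] (Jx Jy : ℝ) :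
    Hcompass L Jx Jy = -∑ e : Bond L, coup Jx Jy e.2 • bondOp e := by
  have hX : ∀ u : Site L, bondSpec (u, true) = sigXX L u := fun u => rfl
  have hY : ∀ u : Site L, bondSpec (u, false) = sigYY L u := fun u => rfl
  rw [Hcompass, Fintype.sum_prod_type (fun e : Bond L => coup Jx Jy e.2 • bondOp e)]
  simp only [Fintype.sum_bool, coup, bondOp, hX, hY, if_true, Bool.false_eq_true, if_false]

theorem sum_pairing_bond (L : ℕ) [NeZero L] (Jx Jy : ℝ) (q : PSpec L → ℂ)
    (hcons : opComm L (Hcompass L Jx Jy) (Qop L q) = 0) (M : Op L) :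
    ∑ e : Bond L, coup Jx Jy e.2 * pairing L q (bondOp e * M - M * bondOp e) = 0 := by
  have h : pairing L q (Hcompass L Jx Jy * M - M * Hcompass L Jx Jy) = 0 := by
    have h0 : Matrix.trace (opComm L (Hcompass L Jx Jy) (Qop L q) * M) = 0 := by simp [hcons]
    rw [opComm, sub_mul, Matrix.trace_sub, mul_assoc, Matrix.trace_mul_comm] at h0
    rw [pairing, mul_sub, Matrix.trace_sub, ← mul_assoc, ← mul_assoc]
    linear_combination -h0
  rw [Hcompass_eq] at h
  have h2 : (-∑ e : Bond L, coup Jx Jy e.2 • bondOp e) * M -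
      M * (-∑ e : Bond L, coup Jx Jy e.2 • bondOp e) =
      -∑ e : Bond L, coup Jx Jy e.2 • (bondOp e * M - M * bondOp e) := by
    simp only [smul_sub, Finset.sum_sub_distrib, neg_mul, mul_neg, Finset.sum_mul, Finset.mul_sum,
      smul_mul_assoc, mul_smul_comm]
    abel
  rw [h2] at h
  simpa [pairing, Finset.mul_sum, Matrix.trace_sum] using h

theorem dir_ne_zero {L : ℕ} (hL : 2 ≤ L) (b : Bool) : dir L b ≠ 0 := by
  have : Fact (1 < L) := ⟨hL⟩
  cases b <;> simp [dir]

theorem ne_add_dir {L : ℕ} (hL : 2 ≤ L) (u : Site L) (b : Bool) : u + dir L b ≠ u := by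
  simpa using dir_ne_zero hL b

theorem bondSpec_lo {L : ℕ} (e : Bond L) : bondSpec e e.1 = ltr e.2 := by simp [bondSpec]

theorem bondSpec_hi {L : ℕ} (e : Bond L) : bondSpec e (e.1 + dir L e.2) = ltr e.2 := by
  simp [bondSpec]

theorem eq_or_eq_of_bondSpec_ne_zero {L : ℕ} {e : Bond L} {v : Site L} (h : bondSpec e v ≠ 0) :
    v = e.1 ∨ v = e.1 + dir L e.2 := by
  simp only [bondSpec] at h
  split_ifs at h with h1 h2 <;> simp_all

theorem bondSpec_eq_zero {L : ℕ} {e : Bond L} {v : Site L} (h1 : v ≠ e.1)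
    (h2 : v ≠ e.1 + dir L e.2) : bondSpec e v = 0 := by
  simp [bondSpec, h1, h2]

theorem bondOp_mul {L : ℕ} [NeZero L] (hL : 2 ≤ L) {e : Bond L} {M : Op L} {τ : PSpec L}
    (hM : IsPauli M τ) : bondOp e * M =
      ((if letterAnti (ltr e.2) (τ e.1) then (-1 : ℂ) else 1) *
        (if letterAnti (ltr e.2) (τ (e.1 + dir L e.2)) then (-1 : ℂ) else 1)) •
        (M * bondOp e) := by
  obtain ⟨c, -, rfl⟩ := hM
  rw [mul_smul_comm, smul_mul_assoc, bondOp, PauliOp_comm, smul_comm c,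
    Finset.prod_eq_mul e.1 (e.1 + dir L e.2) (ne_add_dir hL e.1 e.2).symm, bondSpec_lo, bondSpec_hi]
  · rintro v - ⟨h1, h2⟩
    simp [bondSpec_eq_zero h1 h2, letterAnti]
  · simp
  · simp

theorem bondOp_mul_comm {L : ℕ} [NeZero L] (hL : 2 ≤ L) {e : Bond L} {M : Op L} {τ : PSpec L}
    (hM : IsPauli M τ) (h : ¬ BondAnti e τ) : bondOp e * M = M * bondOp e := by
  rw [BondAnti, not_not] at h
  rw [bondOp_mul hL hM, h]
  split_ifs <;> simp

theorem bondOp_mul_anticomm {L : ℕ} [NeZero L] (hL : 2 ≤ L) {e : Bond L} {M : Op L} {τ : PSpec L}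
    (hM : IsPauli M τ) (h : BondAnti e τ) : bondOp e * M = -(M * bondOp e) := by
  rw [BondAnti] at h
  rw [bondOp_mul hL hM]
  split_ifs <;> simp_all

theorem bondOp_mul_self {L : ℕ} [NeZero L] (e : Bond L) : bondOp e * bondOp e = 1 :=
  PauliOp_mul_self L _

theorem isPauli_bondOp {L : ℕ} [NeZero L] (e : Bond L) : IsPauli (bondOp e) (bondSpec e) :=
  isPauli_PauliOp _

theorem coup_ne_zero {Jx Jy : ℝ} (hJx : Jx ≠ 0) (hJy : Jy ≠ 0) (b : Bool) : coup Jx Jy b ≠ 0 := by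
  cases b <;> simpa [coup]

/-- Only the bonds whose product with `τ` has a nonzero coefficient contribute to the equation
obtained from the coefficient of `τ` in `[H, Q] = 0`. -/
theorem sum_pairing_subset {L : ℕ} [NeZero L] (hL : 2 ≤ L) {Jx Jy : ℝ} {q : PSpec L → ℂ}
    (hcons : opComm L (Hcompass L Jx Jy) (Qop L q) = 0) {M : Op L} {τ : PSpec L}
    (hM : IsPauli M τ) (S : Finset (Bond L))
    (hS : ∀ e, BondAnti e τ → q (mulSpec (bondSpec e) τ) ≠ 0 → e ∈ S) :
    ∑ e ∈ S, coup Jx Jy e.2 * pairing L q (bondOp e * M - M * bondOp e) = 0 := by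
  rw [← sum_pairing_bond L Jx Jy q hcons M]
  refine Finset.sum_subset (Finset.subset_univ _) fun e _ he => ?_
  by_cases h : BondAnti e τ
  · have h0 : q (mulSpec (bondSpec e) τ) = 0 := by
      by_contra h0
      exact he (hS e h h0)
    have h1 : M * bondOp e = -(bondOp e * M) := by rw [bondOp_mul_anticomm hL hM h, neg_neg]
    have h2 : pairing L q (bondOp e * M) = 0 :=
      ((isPauli_bondOp e).mul hM).pairing_eq_zero_iff.2 h0
    rw [h1, ← neg_one_smul ℂ (bondOp e * M), pairing_sub, pairing_smul, h2]
    simp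
  · rw [bondOp_mul_comm hL hM h, sub_self]
    simp [pairing]

theorem ltr_ne_zero (b : Bool) : ltr b ≠ 0 := by cases b <;> decide

theorem ltr_injective {b c : Bool} (h : ltr b = ltr c) : b = c := by revert b c; decide

/-- The diagonal level of a site. -/
def lev {L : ℕ} (u : Site L) : ZMod L := u.1 + u.2

theorem lev_add_dir {L : ℕ} (u : Site L) (b : Bool) : lev (u + dir L b) = lev u + 1 := by
  cases b <;> simp [lev, dir] <;> ring

theorem offset_inj {L : ℕ} {a : ZMod L} {i j : ℕ} (hi : i < L) (hj : j < L)
    (h : a + (i : ZMod L) = a + (j : ZMod L)) : i = j := by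
  have h1 := (ZMod.natCast_eq_natCast_iff' i j L).1 (add_left_cancel h)
  rwa [Nat.mod_eq_of_lt hi, Nat.mod_eq_of_lt hj] at h1

theorem site_ne {L : ℕ} {a : ZMod L} {x y : Site L} (i j : ℕ) (hx : lev x = a + (i : ZMod L))
    (hy : lev y = a + (j : ZMod L)) (hi : i < L) (hj : j < L) (hij : i ≠ j) : x ≠ y := by
  rintro rfl
  exact hij (offset_inj hi hj (hx.symm.trans hy))

theorem mulSpec_bond_of_ne {L : ℕ} {e : Bond L} {σ : PSpec L} {x : Site L} (h1 : x ≠ e.1)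
    (h2 : x ≠ e.1 + dir L e.2) : mulSpec (bondSpec e) σ x = σ x := by
  rw [mulSpec, bondSpec_eq_zero h1 h2, letter_zero_xor]

theorem mulSpec_bond_lo {L : ℕ} (e : Bond L) (σ : PSpec L) :
    mulSpec (bondSpec e) σ e.1 = ltr e.2 ^^^ σ e.1 := by
  rw [mulSpec, bondSpec_lo]

theorem mulSpec_bond_hi {L : ℕ} (e : Bond L) (σ : PSpec L) :
    mulSpec (bondSpec e) σ (e.1 + dir L e.2) = ltr e.2 ^^^ σ (e.1 + dir L e.2) := by
  rw [mulSpec, bondSpec_hi]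

theorem pairing_comm_ne_zero {L : ℕ} [NeZero L] (hL : 2 ≤ L) {q : PSpec L → ℂ} {e : Bond L}
    {M : Op L} {τ : PSpec L} (hM : IsPauli M τ) (he : BondAnti e τ)
    (hq : q (mulSpec (bondSpec e) τ) ≠ 0) :
    pairing L q (bondOp e * M - M * bondOp e) ≠ 0 := by
  have h1 : M * bondOp e = -(bondOp e * M) := by rw [bondOp_mul_anticomm hL hM he, neg_neg]
  have h2 : pairing L q (bondOp e * M) ≠ 0 :=
    mt ((isPauli_bondOp e).mul hM).pairing_eq_zero_iff.1 hq
  rw [h1, sub_neg_eq_add, ← two_smul ℂ, pairing_smul]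
  exact mul_ne_zero two_ne_zero h2

/-- `A` has a nonzero coefficient and occupies both levels `a` and `a + k - 1`. -/
def IsFull {L : ℕ} (q : PSpec L → ℂ) (k : ℕ) (a : ZMod L) (A : PSpec L) : Prop :=
  q A ≠ 0 ∧ (∃ u, lev u = a ∧ A u ≠ 0) ∧ ∃ v, lev v = a + ((k - 1 : ℕ) : ZMod L) ∧ A v ≠ 0

theorem no_width_succ {L : ℕ} {q : PSpec L → ℂ} {k : ℕ} (hkL : 2 * k ≤ L)
    (hW : ∀ A, q A ≠ 0 → ∃ a, DiagBoundAt L A a k) {A : PSpec L} (hA : q A ≠ 0) {u v : Site L}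
    (hu : A u ≠ 0) (hv : A v ≠ 0) (h : lev v = lev u + (k : ZMod L)) : False := by
  obtain ⟨a, ha⟩ := hW A hA
  have h1 := ha u hu
  have h2 := ha v hv
  change (lev u - a).val < k at h1
  change (lev v - a).val < k at h2
  have hkv : (k : ZMod L).val = k := ZMod.val_cast_of_lt (by omega)
  rw [show lev v - a = (lev u - a) + (k : ZMod L) by rw [h]; ring,
    ZMod.val_add_of_lt (by rw [hkv]; omega), hkv] at h2
  omega

theorem cast_pred_add_one {L k : ℕ} (hk : 3 ≤ k) : ((k - 1 : ℕ) : ZMod L) + 1 = (k : ZMod L) := by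
  rw [← Nat.cast_succ, Nat.succ_eq_add_one, Nat.sub_add_cancel (by omega)]

theorem bondAnti_append {L : ℕ} {A : PSpec L} {w : Site L} (hw0 : A w ≠ 0)
    {c : Bool} (hc : A w ≠ ltr c) (hv : A (w + dir L c) = 0) :
    BondAnti (w, c) (mulSpec (bondSpec (w, c)) A) := by
  rw [BondAnti, mulSpec_bond_lo (w, c), mulSpec_bond_hi (w, c), hv]
  have key : ∀ (b : Bool) (s : Fin 4), s ≠ 0 → s ≠ ltr b →
      letterAnti (ltr b) (ltr b ^^^ s) ≠ letterAnti (ltr b) (ltr b ^^^ 0) := by decide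
  exact key c _ hw0 hc

section Width

variable {L : ℕ} [NeZero L] {q : PSpec L → ℂ} {k : ℕ}

theorem IsFull.exists_offset (hk : 3 ≤ k) (hkL : 2 * k ≤ L)
    (hW : ∀ A, q A ≠ 0 → ∃ a, DiagBoundAt L A a k) {a : ZMod L} {A : PSpec L}
    (hA : IsFull q k a A) {v : Site L} (hv : A v ≠ 0) : ∃ i < k, lev v = a + (i : ZMod L) := by
  obtain ⟨hq, ⟨x, hx, hx0⟩, y, hy, hy0⟩ := hA
  obtain ⟨a', ha⟩ := hW A hq
  have h1 := ha x hx0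
  have h2 := ha y hy0
  change (lev x - a').val < k at h1
  change (lev y - a').val < k at h2
  have hkv : ((k - 1 : ℕ) : ZMod L).val = k - 1 := ZMod.val_cast_of_lt (by omega)
  rw [show lev y - a' = (lev x - a') + ((k - 1 : ℕ) : ZMod L) by rw [hx, hy]; ring,
    ZMod.val_add_of_lt (by rw [hkv]; omega), hkv] at h2
  have h3 : lev x - a' = 0 := (ZMod.val_eq_zero _).1 (by omega)
  have h4 : a' = a := by rw [← hx]; exact (sub_eq_zero.1 h3).symm
  refine ⟨(lev v - a).val, h4 ▸ ha v hv, ?_⟩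
  rw [ZMod.natCast_zmod_val]
  ring

theorem IsFull.append_bond (hk : 3 ≤ k) (hkL : 2 * k ≤ L)
    (hW : ∀ A, q A ≠ 0 → ∃ a, DiagBoundAt L A a k) {a : ZMod L} {A : PSpec L}
    (hA : IsFull q k a A) {w : Site L} (hw : lev w = a + ((k - 1 : ℕ) : ZMod L))
    {c : Bool} (hc : A w ≠ ltr c) {e : Bond L} (hne : e ≠ (w, c))
    (hanti : BondAnti e (mulSpec (bondSpec (w, c)) A))
    (hq : q (mulSpec (bondSpec e) (mulSpec (bondSpec (w, c)) A)) ≠ 0) :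
    lev e.1 = a ∧ A e.1 = ltr e.2 ∧ (∀ v, lev v = a → A v ≠ 0 → v = e.1) ∧
      A (e.1 + dir L e.2) ≠ 0 ∧ A (e.1 + dir L e.2) ≠ ltr e.2 ∧
      IsFull q k (a + 1) (mulSpec (bondSpec e) (mulSpec (bondSpec (w, c)) A)) := by
  have hk1 := cast_pred_add_one (L := L) hk
  set v := w + dir L c with hv
  set τ := mulSpec (bondSpec (w, c)) A with hτ
  set A' := mulSpec (bondSpec e) τ with hA'
  have hlv : lev v = a + (k : ZMod L) := by rw [hv, lev_add_dir, hw, ← hk1]; ring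
  have hAv : A v = 0 := by
    by_contra h
    obtain ⟨i, hi, hi2⟩ := hA.exists_offset hk hkL hW h
    exact absurd (offset_inj (by omega) (by omega) (hi2.symm.trans hlv)) (by omega)
  have hτv : τ v = ltr c := by
    rw [hτ, hv, mulSpec_bond_hi (w, c), ← hv, hAv, letter_xor_zero]
  have hτw : τ w ≠ 0 := by
    rw [hτ, mulSpec_bond_lo (w, c), Ne, letter_xor_eq_zero]
    exact fun h => hc h.symm
  have hτx : ∀ x, x ≠ w → x ≠ v → τ x = A x := fun x h1 h2 => mulSpec_bond_of_ne h1 h2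
  obtain ⟨x, hx, hx0⟩ := hA.2.1
  have hx' : lev x = a + ((0 : ℕ) : ZMod L) := by simp [hx]
  have hxw : x ≠ w := site_ne 0 (k - 1) hx' hw (by omega) (by omega) (by omega)
  have hxv : x ≠ v := site_ne 0 k hx' hlv (by omega) (by omega) (by omega)
  have hA'v : A' v ≠ 0 := by
    intro h0
    have h1 : bondSpec e v = ltr c := by
      rw [← hτv]; exact (letter_xor_eq_zero _ _).1 h0
    rcases eq_or_eq_of_bondSpec_ne_zero (h1 ▸ ltr_ne_zero c) with h | h
    · have h2 : e.2 = c := by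
        rw [h, bondSpec_lo] at h1
        exact ltr_injective h1
      have hy : lev (e.1 + dir L e.2) = a + ((k + 1 : ℕ) : ZMod L) := by
        rw [lev_add_dir, ← h, hlv]; push_cast; ring
      have hyw := site_ne _ _ hy hw (by omega) (by omega) (by omega)
      have hyv := site_ne _ _ hy hlv (by omega) (by omega) (by omega)
      have hyx := site_ne _ _ hy hx' (by omega) (by omega) (by omega)
      have hwv := site_ne _ _ hw hlv (by omega) (by omega) (by omega)
      have hAy : A (e.1 + dir L e.2) = 0 := by
        by_contra hh
        obtain ⟨i, hi, hi2⟩ := hA.exists_offset hk hkL hW hh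
        exact absurd (offset_inj (by omega) (by omega) (hi2.symm.trans hy)) (by omega)
      have hfull : IsFull q k a A' := by
        refine ⟨hq, ⟨x, hx, ?_⟩, w, hw, ?_⟩
        · rwa [hA', mulSpec_bond_of_ne (h ▸ hxv) hyx.symm, hτx x hxw hxv]
        · rwa [hA', mulSpec_bond_of_ne (h ▸ hwv) hyw.symm]
      have hA'y : A' (e.1 + dir L e.2) ≠ 0 := by
        rw [hA', mulSpec_bond_hi, hτx _ hyw hyv, hAy, letter_xor_zero]
        exact ltr_ne_zero _
      obtain ⟨i, hi, hi2⟩ := hfull.exists_offset hk hkL hW hA'y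
      exact absurd (offset_inj (by omega) (by omega) (hi2.symm.trans hy)) (by omega)
    · rw [h, bondSpec_hi] at h1
      have h2 := ltr_injective h1
      rw [h2, hv] at h
      exact hne (Prod.ext (add_right_cancel h).symm h2)
  have hempty : ∀ y, lev y = a → A y ≠ 0 → bondSpec e y = A y := by
    intro y hy hy0
    have hy' : lev y = a + ((0 : ℕ) : ZMod L) := by simp [hy]
    have hyw : y ≠ w := site_ne 0 (k - 1) hy' hw (by omega) (by omega) (by omega)
    have hyv : y ≠ v := site_ne 0 k hy' hlv (by omega) (by omega) (by omega)
    rw [← hτx y hyw hyv]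
    refine (letter_xor_eq_zero _ _).1 ?_
    by_contra h0
    exact no_width_succ hkL hW hq (u := y) (v := v) h0 hA'v (by rw [hlv, hy])
  rcases eq_or_eq_of_bondSpec_ne_zero ((hempty x hx hx0).symm ▸ hx0) with h | h
  · rw [h] at hx hx0
    have hy : lev (e.1 + dir L e.2) = a + ((1 : ℕ) : ZMod L) := by
      rw [lev_add_dir, hx]; simp
    have hyw : e.1 + dir L e.2 ≠ w := site_ne _ _ hy hw (by omega) (by omega) (by omega)
    have hyv : e.1 + dir L e.2 ≠ v := site_ne _ _ hy hlv (by omega) (by omega) (by omega)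
    have hlo : A e.1 = ltr e.2 := by rw [← hempty e.1 hx hx0, bondSpec_lo]
    rw [BondAnti, hτx _ hyw hyv, hτx _ (h ▸ hxw) (h ▸ hxv), hlo] at hanti
    have key : ∀ (b : Bool) (s : Fin 4), letterAnti (ltr b) (ltr b) ≠ letterAnti (ltr b) s →
        s ≠ 0 ∧ s ≠ ltr b := by decide
    obtain ⟨k1, k2⟩ := key _ _ hanti
    refine ⟨hx, hlo, ?_, k1, k2, hq, ⟨_, by rw [hy]; simp, ?_⟩, v, ?_, hA'v⟩
    · intro y hy' hy0
      rcases eq_or_eq_of_bondSpec_ne_zero ((hempty y hy' hy0).symm ▸ hy0) with h2 | h2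
      · exact h2
      · exact absurd h2 (site_ne 0 1 (by simpa using hy') hy (by omega) (by omega) (by omega))
    · rw [hA', mulSpec_bond_hi, hτx _ hyw hyv, Ne, letter_xor_eq_zero]
      exact fun h => k2 h.symm
    · rw [hlv, ← hk1]; ring
  · exfalso
    have hz : lev e.1 = lev e.1 + ((0 : ℕ) : ZMod L) := by simp
    have hxz : a = lev e.1 + 1 := by rw [← hx, h, lev_add_dir]
    have hwz : lev w = lev e.1 + (k : ZMod L) := by rw [hw, hxz, ← hk1]; ring
    have hvz : lev v = lev e.1 + ((k + 1 : ℕ) : ZMod L) := by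
      rw [hlv, hxz]; push_cast; ring
    have hzw := site_ne _ _ hz hwz (by omega) (by omega) (by omega)
    have hzv := site_ne _ _ hz hvz (by omega) (by omega) (by omega)
    have hAz : A e.1 = 0 := by
      by_contra hh
      obtain ⟨i, hi, hi2⟩ := hA.exists_offset hk hkL hW hh
      have : lev e.1 + ((0 : ℕ) : ZMod L) = lev e.1 + ((i + 1 : ℕ) : ZMod L) := by
        conv_lhs => rw [← hz, hi2, hxz]
        push_cast; ring
      exact absurd (offset_inj (by omega) (by omega) this) (by omega)
    refine no_width_succ hkL hW hq (u := e.1) (v := w) ?_ ?_ hwz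
    · rw [hA', mulSpec_bond_lo, hτx _ hzw hzv, hAz, letter_xor_zero]
      exact ltr_ne_zero _
    · rwa [hA', mulSpec_bond_of_ne hzw.symm (h ▸ hxw.symm)]

theorem IsFull.append_top_eq_zero (hk : 3 ≤ k) (hkL : 2 * k ≤ L)
    (hW : ∀ A, q A ≠ 0 → ∃ a, DiagBoundAt L A a k) {a : ZMod L} {A : PSpec L}
    (hA : IsFull q k a A) {w : Site L} (hw : lev w = a + ((k - 1 : ℕ) : ZMod L)) (c : Bool) :
    A (w + dir L c) = 0 := by
  have hk1 := cast_pred_add_one (L := L) hk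
  by_contra h
  obtain ⟨i, hi, hi2⟩ := hA.exists_offset hk hkL hW h
  rw [lev_add_dir, hw, add_assoc, hk1] at hi2
  exact absurd (offset_inj (by omega) (by omega) hi2) (by omega)

/-- Appending a bond at the top right and truncating the bottom left of a Pauli product of full
diagonal length. -/
theorem IsFull.exists_shift (hk : 3 ≤ k) (hkL : 2 * k ≤ L)
    (hW : ∀ A, q A ≠ 0 → ∃ a, DiagBoundAt L A a k) {Jx Jy : ℝ} (hJx : Jx ≠ 0) (hJy : Jy ≠ 0)
    (hcons : opComm L (Hcompass L Jx Jy) (Qop L q) = 0) {a : ZMod L} {A : PSpec L}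
    (hA : IsFull q k a A) {w : Site L} (hw : lev w = a + ((k - 1 : ℕ) : ZMod L)) (hw0 : A w ≠ 0)
    {c : Bool} (hc : A w ≠ ltr c) :
    ∃ e : Bond L, lev e.1 = a ∧ A e.1 = ltr e.2 ∧ (∀ v, lev v = a → A v ≠ 0 → v = e.1) ∧
      A (e.1 + dir L e.2) ≠ 0 ∧ A (e.1 + dir L e.2) ≠ ltr e.2 ∧
      IsFull q k (a + 1) (mulSpec (bondSpec e) (mulSpec (bondSpec (w, c)) A)) := by
  have hv := hA.append_top_eq_zero hk hkL hW hw c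
  have hanti := bondAnti_append hw0 hc hv
  by_contra! hno
  have hM := (isPauli_bondOp (w, c)).mul (isPauli_PauliOp (L := L) A)
  have hsum := sum_pairing_subset (by omega) hcons hM {(w, c)} (fun e he hq => by
    by_contra hne
    obtain ⟨h1, h2, h3, h4, h5, h6⟩ := hA.append_bond hk hkL hW hw hc
      (fun h => hne (Finset.mem_singleton.2 h)) he hq
    exact hno e h1 h2 h3 h4 h5 h6)
  rw [Finset.sum_singleton] at hsum
  refine mul_ne_zero (coup_ne_zero hJx hJy _) (pairing_comm_ne_zero (by omega) hM hanti ?_) hsum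
  rw [mulSpec_cancel_left]
  exact hA.1

end Width

/-- The sites of the staircase starting at `u` with a step in the direction of `b`, the steps
alternating between the two directions. -/
def stairSite {L : ℕ} : Bool → Site L → ℕ → Site L
  | _, u, 0 => u
  | b, u, n + 1 => stairSite (!b) (u + dir L b) n

/-- The type of the `n`-th bond of a staircase. -/
def stairFlag : Bool → ℕ → Bool
  | b, 0 => b
  | b, n + 1 => stairFlag (!b) n

theorem stairFlag_not (b : Bool) (n : ℕ) : stairFlag (!b) n = !stairFlag b n := by
  induction n generalizing b with
  | zero => rfl
  | succ n ih => simp only [stairFlag]; rw [ih]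

theorem stairFlag_succ (b : Bool) (n : ℕ) : stairFlag b (n + 1) = !stairFlag b n :=
  stairFlag_not b n

theorem stairFlag_add_two_mul (b : Bool) (n m : ℕ) :
    stairFlag b (n + 2 * m) = stairFlag b n := by
  induction m with
  | zero => rfl
  | succ m ih =>
    rw [show n + 2 * (m + 1) = n + 2 * m + 1 + 1 by ring, stairFlag_succ, stairFlag_succ, ih,
      Bool.not_not]

theorem stairSite_succ {L : ℕ} (b : Bool) (u : Site L) (n : ℕ) :
    stairSite b u (n + 1) = stairSite b u n + dir L (stairFlag b n) := by
  induction n generalizing b u with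
  | zero => rfl
  | succ n ih =>
    rw [stairSite, ih]
    rfl

theorem lev_stairSite {L : ℕ} (b : Bool) (u : Site L) (n : ℕ) :
    lev (stairSite b u n) = lev u + (n : ZMod L) := by
  induction n with
  | zero => simp [stairSite]
  | succ n ih => rw [stairSite_succ, lev_add_dir, ih]; push_cast; ring

section Staircase

variable {L : ℕ} [NeZero L] {q : PSpec L → ℂ} {k : ℕ}

theorem exists_ne_ltr (s : Fin 4) : ∃ c, s ≠ ltr c := by revert s; decide

/-- The lowest `m + 1` levels of a Pauli product of full diagonal length form a staircase. -/
theorem IsFull.exists_stair (hk : 3 ≤ k) (hkL : 2 * k ≤ L)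
    (hW : ∀ A, q A ≠ 0 → ∃ a, DiagBoundAt L A a k) {Jx Jy : ℝ} (hJx : Jx ≠ 0) (hJy : Jy ≠ 0)
    (hcons : opComm L (Hcompass L Jx Jy) (Qop L q) = 0) (m : ℕ) (hm : m ≤ k - 1) {a : ZMod L}
    {A : PSpec L} (hA : IsFull q k a A) :
    ∃ (b : Bool) (u : Site L), lev u = a ∧ A u = ltr b ∧
      (∀ i ≤ m, ∀ v, lev v = a + (i : ZMod L) → (A v ≠ 0 ↔ v = stairSite b u i)) ∧
      ∀ i, 1 ≤ i → i ≤ m → i ≤ k - 2 → A (stairSite b u i) = 3 := by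
  induction m generalizing a A with
  | zero =>
    obtain ⟨w, hw, hw0⟩ := hA.2.2
    obtain ⟨c, hc⟩ := exists_ne_ltr (A w)
    obtain ⟨⟨u, b⟩, h1, h2, h3, -⟩ := hA.exists_shift hk hkL hW hJx hJy hcons hw hw0 hc
    refine ⟨b, u, h1, h2, fun i hi v hv => ?_, fun i hi hi2 => absurd hi (by omega)⟩
    obtain rfl : i = 0 := by omega
    simp only [Nat.cast_zero, add_zero] at hv
    refine ⟨h3 v hv, ?_⟩
    rintro rfl
    rw [show A v = ltr b from h2]
    exact ltr_ne_zero b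
  | succ m ih =>
    obtain ⟨w, hw, hw0⟩ := hA.2.2
    obtain ⟨c, hc⟩ := exists_ne_ltr (A w)
    obtain ⟨⟨l, b⟩, h1, h2, h3, h4, h5, hfull⟩ :=
      hA.exists_shift hk hkL hW hJx hJy hcons hw hw0 hc
    obtain ⟨b', u, hu, hub, hlev, hZ⟩ := ih (by omega) hfull
    have hk1 := cast_pred_add_one (L := L) hk
    dsimp only at h1 h2 h3 h4 h5
    set A' := mulSpec (bondSpec (l, b)) (mulSpec (bondSpec (w, c)) A) with hA'
    have hl : lev l = a + ((0 : ℕ) : ZMod L) := by simp [h1]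
    have hl1 : lev (l + dir L b) = a + ((1 : ℕ) : ZMod L) := by rw [lev_add_dir, h1]; simp
    have hwc : lev (w + dir L c) = a + ((k : ℕ) : ZMod L) := by
      rw [lev_add_dir, hw, add_assoc, hk1]
    have hA'1 : A' (l + dir L b) = ltr b ^^^ A (l + dir L b) := by
      rw [hA', mulSpec_bond_hi (l, b), mulSpec_bond_of_ne]
      · exact site_ne _ _ hl1 hw (by omega) (by omega) (by omega)
      · exact site_ne _ _ hl1 hwc (by omega) (by omega) (by omega)
    have hA'1' : A' (l + dir L b) ≠ 0 := by
      rw [hA'1, Ne, letter_xor_eq_zero]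
      exact fun h => h5 h.symm
    have hA'w : A' w ≠ 0 := by
      rw [hA', mulSpec_bond_of_ne, mulSpec_bond_lo (w, c), Ne, letter_xor_eq_zero]
      · exact fun h => hc h.symm
      · exact site_ne _ _ hw hl (by omega) (by omega) (by omega)
      · exact site_ne _ _ hw hl1 (by omega) (by omega) (by omega)
    have hA'x : ∀ i, 2 ≤ i → i ≤ k - 1 → ∀ v, lev v = a + (i : ZMod L) → v ≠ w → A' v = A v := by
      intro i hi hi2 v hv hvw
      rw [hA', mulSpec_bond_of_ne, mulSpec_bond_of_ne hvw]
      · exact site_ne _ _ hv hwc (by omega) (by omega) (by omega)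
      · exact site_ne _ _ hv hl (by omega) (by omega) (by omega)
      · exact site_ne _ _ hv hl1 (by omega) (by omega) (by omega)
    have hul : l + dir L b = u :=
      (hlev 0 (by omega) _ (by rw [hl1]; simp)).1 hA'1'
    have hbb : A (l + dir L b) = 3 ∧ b' = !b := by
      have key : ∀ (b b' : Bool) (s : Fin 4), s ≠ 0 → s ≠ ltr b → ltr b ^^^ s = ltr b' →
          s = 3 ∧ b' = !b := by decide
      exact key _ _ _ h4 h5 (by rw [← hA'1, hul, hub])
    obtain ⟨hA3, rfl⟩ := hbb
    subst hul
    refine ⟨b, l, h1, h2, ?_, ?_⟩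
    · intro i hi v hv
      rcases i with _ | i
      · simp only [Nat.cast_zero, add_zero] at hv
        refine ⟨h3 v hv, ?_⟩
        rintro rfl
        rw [h2]
        exact ltr_ne_zero b
      · rw [stairSite, ← hlev i (by omega) v (by rw [hv]; push_cast; ring)]
        by_cases hvw : v = w
        · rw [hvw]; exact iff_of_true hw0 hA'w
        rcases i with _ | i
        · have h6 := hlev 0 (by omega) v (by rw [hv]; push_cast; ring)
          constructor
          · intro h7
            by_cases hvl : v = l + dir L b
            · rw [hvl]; exact hA'1'
            · rwa [hA', mulSpec_bond_of_ne _ hvl, mulSpec_bond_of_ne hvw]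
              · exact site_ne _ _ hv hwc (by omega) (by omega) (by omega)
              · exact site_ne _ _ hv hl (by omega) (by omega) (by omega)
          · intro h7
            rw [h6.1 h7]
            exact h4
        · rw [hA'x (i + 1 + 1) (by omega) (by omega) v hv hvw]
    · intro i hi1 hi2 hi3
      rcases i with _ | i
      · omega
      rcases i with _ | i
      · exact hA3
      · rw [stairSite, ← hZ (i + 1) (by omega) (by omega) (by omega)]
        have hlv : lev (stairSite (!b) (l + dir L b) (i + 1)) =
            a + ((i + 1 + 1 : ℕ) : ZMod L) := by
          rw [lev_stairSite, hl1]; push_cast; ring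
        exact (hA'x (i + 1 + 1) (by omega) (by omega) _ hlv
          (site_ne _ _ hlv hw (by omega) (by omega) (by omega))).symm

end Staircase

theorem mulSpec_comm {L : ℕ} (σ τ : PSpec L) : mulSpec σ τ = mulSpec τ σ := by
  have key : ∀ a b : Fin 4, a ^^^ b = b ^^^ a := by decide
  exact funext fun v => key _ _

theorem mulSpec_assoc {L : ℕ} (σ τ ρ : PSpec L) :
    mulSpec (mulSpec σ τ) ρ = mulSpec σ (mulSpec τ ρ) := by
  have key : ∀ a b c : Fin 4, a ^^^ b ^^^ c = a ^^^ (b ^^^ c) := by decide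
  exact funext fun v => key _ _ _

theorem dir_injective {L : ℕ} (hL : 2 ≤ L) {c d : Bool} (h : dir L c = dir L d) : c = d := by
  have : Fact (1 < L) := ⟨hL⟩
  cases c <;> cases d <;> simp_all [dir]

/-- The `j`-th bond of a staircase. -/
def stairBond {L : ℕ} (b : Bool) (u : Site L) (j : ℕ) : Bond L := (stairSite b u j, stairFlag b j)

/-- The Pauli product of the `n` consecutive bonds of a staircase from the `j`-th on. -/
def chainSpec {L : ℕ} (b : Bool) (u : Site L) : ℕ → ℕ → PSpec L
  | _, 0 => 0
  | j, n + 1 => mulSpec (bondSpec (stairBond b u j)) (chainSpec b u (j + 1) n)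

/-- The operator product of the `n` consecutive bonds of a staircase from the `j`-th on. -/
noncomputable def chainOp {L : ℕ} [NeZero L] (b : Bool) (u : Site L) : ℕ → ℕ → Op L
  | _, 0 => 1
  | j, n + 1 => bondOp (stairBond b u j) * chainOp b u (j + 1) n

theorem isPauli_chainOp {L : ℕ} [NeZero L] (b : Bool) (u : Site L) (j n : ℕ) :
    IsPauli (chainOp b u j n) (chainSpec b u j n) := by
  induction n generalizing j with
  | zero => exact isPauli_one
  | succ n ih => exact (isPauli_bondOp _).mul (ih _)

theorem chainOp_succ' {L : ℕ} [NeZero L] (b : Bool) (u : Site L) (j n : ℕ) :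
    chainOp b u j (n + 1) = chainOp b u j n * bondOp (stairBond b u (j + n)) := by
  induction n generalizing j with
  | zero => simp [chainOp]
  | succ n ih =>
    rw [chainOp, ih, chainOp, mul_assoc, show j + 1 + n = j + (n + 1) by ring]

theorem chainSpec_succ' {L : ℕ} (b : Bool) (u : Site L) (j n : ℕ) :
    chainSpec b u j (n + 1) = mulSpec (bondSpec (stairBond b u (j + n))) (chainSpec b u j n) := by
  induction n generalizing j with
  | zero => rfl
  | succ n ih =>
    rw [chainSpec, ih, chainSpec, ← mulSpec_assoc, ← mulSpec_assoc,
      mulSpec_comm (bondSpec (stairBond b u j)), show j + 1 + n = j + (n + 1) by ring]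

theorem stairBond_hi {L : ℕ} (b : Bool) (u : Site L) (j : ℕ) :
    (stairBond b u j).1 + dir L (stairBond b u j).2 = stairSite b u (j + 1) :=
  (stairSite_succ b u j).symm

theorem stairSite_inj {L : ℕ} {b : Bool} {u : Site L} {i j : ℕ} (hi : i < L) (hj : j < L) :
    stairSite b u i = stairSite b u j ↔ i = j := by
  refine ⟨fun h => ?_, fun h => h ▸ rfl⟩
  by_contra hij
  exact site_ne i j (lev_stairSite b u i) (lev_stairSite b u j) hi hj hij h

theorem bondSpec_stairBond {L : ℕ} (b : Bool) (u : Site L) {i m : ℕ} (hi : i + 1 < L) (hm : m < L) :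
    bondSpec (stairBond b u i) (stairSite b u m) =
      if m = i ∨ m = i + 1 then ltr (stairFlag b i) else 0 := by
  simp only [bondSpec, stairBond_hi]
  simp only [stairBond, stairSite_inj hm hi, stairSite_inj hm (show i < L by omega)]
  split_ifs <;> first | rfl | omega

theorem chainSpec_apply {L : ℕ} (b : Bool) (u : Site L) {j n m : ℕ} (hj : j + n < L) (hm : m < L) :
    chainSpec b u j n (stairSite b u m) =
      (if j ≤ m ∧ m < j + n then ltr (stairFlag b m) else 0) ^^^
        (if j < m ∧ m ≤ j + n then ltr (!stairFlag b m) else 0) := by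
  induction n generalizing j with
  | zero =>
    rw [if_neg (by omega), if_neg (by omega)]; rfl
  | succ n ih =>
    rw [chainSpec, mulSpec, ih (by omega), bondSpec_stairBond b u (by omega) hm]
    by_cases h1 : m = j
    · subst h1
      rw [if_pos (by omega), if_neg (by omega), if_neg (by omega), if_pos (by omega),
        if_neg (by omega)]
      rfl
    by_cases h2 : m = j + 1
    · subst h2
      rw [if_pos (by omega), if_neg (c := j + 1 < j + 1 ∧ _) (by omega),
        if_pos (c := j < j + 1 ∧ _) (by omega), stairFlag_succ, Bool.not_not, letter_xor_zero]
      have key : ∀ a b : Fin 4, a ^^^ b = b ^^^ a := by decide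
      rw [key]
      congr 2
      simp only [eq_iff_iff]
      omega
    · rw [if_neg (by omega), letter_zero_xor]
      congr 2 <;> (simp only [eq_iff_iff]; omega)

theorem exists_of_chainSpec_ne_zero {L : ℕ} {b : Bool} {u : Site L} {j n : ℕ} {v : Site L}
    (h : chainSpec b u j n v ≠ 0) : ∃ m, j ≤ m ∧ m ≤ j + n ∧ v = stairSite b u m := by
  induction n generalizing j with
  | zero => exact absurd rfl h
  | succ n ih =>
    by_cases h1 : chainSpec b u (j + 1) n v = 0
    · rw [chainSpec, mulSpec, h1, letter_xor_zero] at h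
      rcases eq_or_eq_of_bondSpec_ne_zero h with h | h
      · exact ⟨j, le_rfl, by omega, h⟩
      · exact ⟨j + 1, by omega, by omega, by rw [h, stairBond_hi]⟩
    · obtain ⟨m, h2, h3, h4⟩ := ih h1
      exact ⟨m, by omega, by omega, h4⟩

theorem ltr_xor_ltr_not (b : Bool) : ltr b ^^^ ltr (!b) = 3 := by revert b; decide

section Chain

variable {L : ℕ} {b : Bool} {u : Site L}

theorem chainSpec_lo {j n : ℕ} (hn : 1 ≤ n) (hj : j + n < L) :
    chainSpec b u j n (stairSite b u j) = ltr (stairFlag b j) := by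
  rw [chainSpec_apply b u hj (by omega), if_pos (by omega), if_neg (by omega), letter_xor_zero]

theorem chainSpec_hi {j n : ℕ} (hn : 1 ≤ n) (hj : j + n < L) :
    chainSpec b u j n (stairSite b u (j + n)) = ltr (!stairFlag b (j + n)) := by
  rw [chainSpec_apply b u hj (by omega), if_neg (by omega), if_pos (by omega), letter_zero_xor]

theorem chainSpec_interior {j n m : ℕ} (hj : j + n < L) (h1 : j < m) (h2 : m < j + n) :
    chainSpec b u j n (stairSite b u m) = 3 := by
  rw [chainSpec_apply b u hj (by omega), if_pos (by omega), if_pos (by omega), ltr_xor_ltr_not]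

theorem chainSpec_outside {j n m : ℕ} (hj : j + n < L) (hm : m < L) (h : m < j ∨ j + n < m) :
    chainSpec b u j n (stairSite b u m) = 0 := by
  rw [chainSpec_apply b u hj hm, if_neg (by omega), if_neg (by omega), letter_xor_zero]

theorem bondAnti_chain_lo {j n : ℕ} (hn : 1 ≤ n) (hj : j + 1 + n < L) :
    BondAnti (stairBond b u j) (chainSpec b u (j + 1) n) := by
  rw [BondAnti, stairBond_hi, chainSpec_lo hn hj]
  simp only [stairBond]
  rw [chainSpec_outside hj (by omega) (by omega), stairFlag_succ]
  cases stairFlag b j <;> decide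

theorem bondAnti_chain_hi {j n : ℕ} (hn : 1 ≤ n) (hj : j + n + 1 < L) :
    BondAnti (stairBond b u (j + n)) (chainSpec b u j n) := by
  rw [BondAnti, stairBond_hi, chainSpec_outside (by omega) (by omega) (by omega)]
  simp only [stairBond]
  rw [chainSpec_hi hn (by omega)]
  cases stairFlag b (j + n) <;> decide

theorem isFull_chain {q : PSpec L → ℂ} {k j : ℕ} (hk : 3 ≤ k) (hj : j + k ≤ L)
    (hq : q (chainSpec b u j (k - 1)) ≠ 0) :
    IsFull q k (lev u + (j : ZMod L)) (chainSpec b u j (k - 1)) := by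
  refine ⟨hq, ⟨stairSite b u j, lev_stairSite _ _ _, ?_⟩, stairSite b u (j + (k - 1)), ?_, ?_⟩
  · rw [chainSpec_lo (by omega) (by omega)]
    exact ltr_ne_zero _
  · rw [lev_stairSite, Nat.cast_add, add_assoc]
  · rw [chainSpec_hi (by omega) (by omega)]
    exact ltr_ne_zero _

variable [NeZero L] {q : PSpec L → ℂ} {k : ℕ}

/-- A Pauli product of full diagonal length with a nonzero coefficient is in standard form. -/
theorem IsFull.eq_chain (hk : 3 ≤ k) (hkL : 2 * k ≤ L)
    (hW : ∀ A, q A ≠ 0 → ∃ a, DiagBoundAt L A a k) {Jx Jy : ℝ} (hJx : Jx ≠ 0) (hJy : Jy ≠ 0)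
    (hcons : opComm L (Hcompass L Jx Jy) (Qop L q) = 0) {a : ZMod L}
    {A : PSpec L} (hA : IsFull q k a A) :
    ∃ (b : Bool) (u : Site L), A = chainSpec b u 0 (k - 1) := by
  have hk1 := cast_pred_add_one (L := L) hk
  obtain ⟨b, u, hu, hub, hlev, hZ⟩ := hA.exists_stair hk hkL hW hJx hJy hcons (k - 1) le_rfl
  refine ⟨b, u, ?_⟩
  have hlw : ∀ i, lev (stairSite b u i) = a + (i : ZMod L) := fun i => by rw [lev_stairSite, hu]
  have hw0 : A (stairSite b u (k - 1)) ≠ 0 := (hlev (k - 1) le_rfl _ (hlw _)).2 rfl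
  have htop : ∀ c, A (stairSite b u (k - 1)) ≠ ltr c → c = stairFlag b (k - 1) := by
    intro c hc
    obtain ⟨⟨l, f⟩, h1, h2, h3, h4, h5, hfull⟩ :=
      hA.exists_shift hk hkL hW hJx hJy hcons (hlw (k - 1)) hw0 hc
    obtain ⟨b', u', hu', hub', hlev', -⟩ :=
      hfull.exists_stair hk hkL hW hJx hJy hcons (k - 1) le_rfl
    dsimp only at h1 h2 h3 h4 h5
    set w := stairSite b u (k - 1) with hw
    set A' := mulSpec (bondSpec (l, f)) (mulSpec (bondSpec (w, c)) A) with hA'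
    have hlw' := hlw (k - 1)
    rw [← hw] at hlw'
    have hl : lev l = a + ((0 : ℕ) : ZMod L) := by simp [h1]
    have hl1 : lev (l + dir L f) = a + ((1 : ℕ) : ZMod L) := by rw [lev_add_dir, h1]; simp
    have hwc : lev (w + dir L c) = a + ((k : ℕ) : ZMod L) := by
      rw [lev_add_dir, hlw', add_assoc, hk1]
    obtain rfl : u = l := h3 u hu (hub ▸ ltr_ne_zero b)
    obtain rfl : b = f := ltr_injective (hub.symm.trans h2)
    have hA'1 : A' (u + dir L b) = ltr b ^^^ A (u + dir L b) := by
      rw [hA', mulSpec_bond_hi (u, b), mulSpec_bond_of_ne]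
      · exact site_ne _ _ hl1 hlw' (by omega) (by omega) (by omega)
      · exact site_ne _ _ hl1 hwc (by omega) (by omega) (by omega)
    have hA'v : A' (w + dir L c) ≠ 0 := by
      rw [hA', mulSpec_bond_of_ne, mulSpec_bond_hi (w, c),
        hA.append_top_eq_zero hk hkL hW hlw', letter_xor_zero]
      · exact ltr_ne_zero _
      · exact site_ne _ _ hwc hl (by omega) (by omega) (by omega)
      · exact site_ne _ _ hwc hl1 (by omega) (by omega) (by omega)
    obtain rfl : u + dir L b = u' := by
      refine (hlev' 0 (by omega) _ (by rw [hl1]; simp)).1 ?_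
      rw [hA'1, Ne, letter_xor_eq_zero]
      exact fun h => h5 h.symm
    have hbb : b' = !b := by
      have key : ∀ (b b' : Bool) (s : Fin 4), s ≠ 0 → s ≠ ltr b → ltr b ^^^ s = ltr b' →
          b' = !b := by decide
      exact key _ _ _ h4 h5 (by rw [← hA'1, hub'])
    subst hbb
    have h6 : w + dir L c = stairSite (!b) (u + dir L b) (k - 1) :=
      (hlev' (k - 1) le_rfl _ (by rw [hwc, ← hk1]; ring)).1 hA'v
    have h7 : stairSite (!b) (u + dir L b) (k - 1) = stairSite b u (k - 1 + 1) := rfl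
    rw [h7, stairSite_succ, ← hw] at h6
    exact dir_injective (by omega) (add_left_cancel h6)
  have htop' : A (stairSite b u (k - 1)) = ltr (!stairFlag b (k - 1)) := by
    by_contra h
    have := htop _ h
    simp at this
  funext v
  by_cases hv : ∃ i ≤ k - 1, v = stairSite b u i
  · obtain ⟨i, hi, rfl⟩ := hv
    rcases Nat.eq_zero_or_pos i with rfl | hi0
    · rw [chainSpec_lo (by omega) (by omega)]
      exact hub
    · rcases hi.eq_or_lt with rfl | hi2
      · have := chainSpec_hi (b := b) (u := u) (j := 0) (n := k - 1) (by omega) (by omega)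
        rw [Nat.zero_add] at this
        rw [this, htop']
      · rw [hZ i (by omega) (by omega) (by omega), chainSpec_interior (by omega) hi0 (by omega)]
  · have h1 : A v = 0 := by
      by_contra h
      obtain ⟨i, hi, hi2⟩ := hA.exists_offset hk hkL hW h
      exact hv ⟨i, by omega, (hlev i (by omega) v hi2).1 h⟩
    have h2 : chainSpec b u 0 (k - 1) v = 0 := by
      by_contra h
      obtain ⟨m, -, h3, h4⟩ := exists_of_chainSpec_ne_zero h
      exact hv ⟨m, by omega, h4⟩
    rw [h1, h2]

/-- Consecutive standard-form products on a staircase have the same coefficient, when it is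
measured by the operator product of the bonds. -/
theorem pairing_chain_succ (hk : 3 ≤ k) (hodd : k % 2 = 1) (hkL : 2 * k ≤ L)
    (hW : ∀ A, q A ≠ 0 → ∃ a, DiagBoundAt L A a k) {Jx Jy : ℝ} (hJx : Jx ≠ 0) (hJy : Jy ≠ 0)
    (hcons : opComm L (Hcompass L Jx Jy) (Qop L q) = 0) {j : ℕ} (hj : j + k < L)
    (hq : q (chainSpec b u j (k - 1)) ≠ 0) :
    pairing L q (chainOp b u (j + 1) (k - 1)) = pairing L q (chainOp b u j (k - 1)) := by
  have hfull := isFull_chain hk (by omega) hq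
  have hL : 2 ≤ L := by omega
  obtain ⟨n, rfl⟩ : ∃ n, k = n + 1 := ⟨k - 1, by omega⟩
  simp only [Nat.add_sub_cancel] at hfull hq ⊢
  have hM := isPauli_chainOp b u j (n + 1)
  have hne : stairBond b u j ≠ stairBond b u (j + n) := fun h => by
    have := (stairSite_inj (by omega) (by omega)).1 (congrArg Prod.fst h)
    omega
  have htop := chainSpec_hi (b := b) (u := u) (j := j) (n := n) (by omega) (by omega)
  have hsum := sum_pairing_subset hL hcons hM {stairBond b u j, stairBond b u (j + n)}
    (fun e he hqe => by
      by_contra hmem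
      simp only [Finset.mem_insert, Finset.mem_singleton, not_or] at hmem
      rw [chainSpec_succ'] at he hqe
      have hw : lev (stairSite b u (j + n)) = lev u + (j : ZMod L) + ((n + 1 - 1 : ℕ) : ZMod L) := by
        rw [lev_stairSite]; push_cast; ring
      obtain ⟨h1, h2, h3, -⟩ := hfull.append_bond hk hkL hW hw
        (c := stairFlag b (j + n)) (by
          rw [htop]; intro h; simpa using ltr_injective h) hmem.2 he hqe
      have hlo := chainSpec_lo (b := b) (u := u) (j := j) (n := n) (by omega) (by omega)
      have h4 := h3 (stairSite b u j) (lev_stairSite b u j) (hlo ▸ ltr_ne_zero _)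
      rw [← h4, hlo] at h2
      exact hmem.1 (Prod.ext h4.symm (ltr_injective h2).symm))
  rw [Finset.sum_pair hne] at hsum
  have e1 : bondOp (stairBond b u j) * chainOp b u j (n + 1) -
      chainOp b u j (n + 1) * bondOp (stairBond b u j) = (2 : ℂ) • chainOp b u (j + 1) n := by
    have h := bondOp_mul_anticomm hL (isPauli_chainOp b u (j + 1) n)
      (bondAnti_chain_lo (by omega) (by omega))
    rw [chainOp, ← mul_assoc, bondOp_mul_self, one_mul, h, neg_mul, mul_assoc, bondOp_mul_self,
      mul_one, sub_neg_eq_add, two_smul]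
  have e2 : bondOp (stairBond b u (j + n)) * chainOp b u j (n + 1) -
      chainOp b u j (n + 1) * bondOp (stairBond b u (j + n)) = (-2 : ℂ) • chainOp b u j n := by
    have h := bondOp_mul_anticomm hL (isPauli_chainOp b u j n)
      (bondAnti_chain_hi (by omega) (by omega))
    rw [chainOp_succ', ← mul_assoc, h, neg_mul, mul_assoc, bondOp_mul_self, mul_one, neg_smul,
      two_smul]
    abel
  have hfl : stairFlag b (j + n) = stairFlag b j := by
    rw [show n = 2 * (n / 2) by omega, stairFlag_add_two_mul]
  rw [e1, e2, pairing_smul, pairing_smul] at hsum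
  simp only [stairBond, hfl] at hsum
  refine mul_left_cancel₀ (mul_ne_zero (coup_ne_zero hJx hJy (stairFlag b j)) two_ne_zero) ?_
  linear_combination hsum

end Chain

/-- The bond branching off a staircase at its `n`-th site. -/
def branchBond {L : ℕ} (b : Bool) (u : Site L) (n : ℕ) : Bond L :=
  (stairSite b u n, !stairFlag b n)

section Branch

variable {L : ℕ} {b : Bool} {u : Site L}

theorem lev_branchBond_hi (n : ℕ) :
    lev ((branchBond b u n).1 + dir L (branchBond b u n).2) = lev u + ((n + 1 : ℕ) : ZMod L) := by
  rw [lev_add_dir, branchBond, lev_stairSite]; push_cast; ring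

theorem branchBond_hi_ne {n m : ℕ} (hn : n + 1 < L) (hm : m < L) :
    (branchBond b u n).1 + dir L (branchBond b u n).2 ≠ stairSite b u m := by
  intro h
  have h1 := lev_branchBond_hi (b := b) (u := u) n
  rw [h, lev_stairSite] at h1
  obtain rfl := offset_inj hm hn h1
  rw [stairSite_succ] at h
  have := dir_injective (by omega) (add_left_cancel h)
  simp [branchBond] at this

theorem bondSpec_branchBond {n m : ℕ} (hn : n + 1 < L) (hm : m < L) :
    bondSpec (branchBond b u n) (stairSite b u m) = if m = n then ltr (!stairFlag b n) else 0 := by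
  simp only [bondSpec, (branchBond_hi_ne hn hm).symm, if_false]
  simp only [branchBond, stairSite_inj hm (show n < L by omega)]

theorem chainSpec_branchBond_hi {n j m : ℕ} (hn : n + 1 < L) (hj : j + m < L) :
    chainSpec b u j m ((branchBond b u n).1 + dir L (branchBond b u n).2) = 0 := by
  by_contra h
  obtain ⟨i, -, hi, h⟩ := exists_of_chainSpec_ne_zero h
  exact branchBond_hi_ne hn (by omega) h

theorem branchBond_ne_stairBond {n i : ℕ} (hn : n < L) (hi : i < L) :
    branchBond b u n ≠ stairBond b u i := by
  intro h
  obtain rfl := (stairSite_inj hn hi).1 (congrArg Prod.fst h)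
  have := congrArg Prod.snd h
  simp [branchBond, stairBond] at this

theorem bondAnti_stairBond_branchBond {n i : ℕ} (hn : n + 1 < L) (hi : i + 1 < L) :
    BondAnti (stairBond b u i) (bondSpec (branchBond b u n)) ↔ i = n := by
  rw [BondAnti, stairBond_hi, bondSpec_branchBond hn hi]
  simp only [stairBond]
  rw [bondSpec_branchBond hn (by omega)]
  split_ifs with h1 h2 h2
  · omega
  · rw [iff_true_right h1, h1]
    cases stairFlag b n <;> decide
  · rw [iff_false_right h1, ← h2, stairFlag_succ, Bool.not_not]
    cases stairFlag b i <;> decide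
  · simp [h1]

theorem bondAnti_branchBond_chain {n j m : ℕ} (hjn : j ≤ n) (hnm : n < j + m) (hj : j + m < L) :
    BondAnti (branchBond b u n) (chainSpec b u j m) := by
  rw [BondAnti, chainSpec_branchBond_hi (by omega) hj]
  simp only [branchBond]
  rcases hjn.eq_or_lt with rfl | hjn
  · rw [chainSpec_lo (by omega) hj]
    cases stairFlag b j <;> decide
  · rw [chainSpec_interior hj hjn hnm]
    cases stairFlag b n <;> decide

variable {k j : ℕ}

theorem lev_of_branch_ne_zero (hjk : j + 2 ≤ k) {v : Site L}
    (h : mulSpec (bondSpec (branchBond b u (k - 2))) (chainSpec b u j (k - 1)) v ≠ 0) :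
    ∃ m, j ≤ m ∧ m < j + k ∧ lev v = lev u + (m : ZMod L) ∧
      (v = (branchBond b u (k - 2)).1 + dir L (branchBond b u (k - 2)).2 ∨
        v = stairSite b u m) := by
  by_cases h1 : chainSpec b u j (k - 1) v = 0
  · rw [mulSpec, h1, letter_xor_zero] at h
    rcases eq_or_eq_of_bondSpec_ne_zero h with h | h
    · exact ⟨k - 2, by omega, by omega, by rw [h, branchBond, lev_stairSite], Or.inr h⟩
    · exact ⟨k - 2 + 1, by omega, by omega, by rw [h, lev_branchBond_hi], Or.inl h⟩
  · obtain ⟨m, h2, h3, h4⟩ := exists_of_chainSpec_ne_zero h1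
    exact ⟨m, h2, by omega, by rw [h4, lev_stairSite], Or.inr h4⟩

variable [NeZero L] {q : PSpec L → ℂ}

theorem mem_of_branch_ne_zero (hk : 3 ≤ k) (hkL : 2 * k ≤ L)
    (hW : ∀ A, q A ≠ 0 → ∃ a, DiagBoundAt L A a k) {Jx Jy : ℝ} (hJx : Jx ≠ 0) (hJy : Jy ≠ 0)
    (hcons : opComm L (Hcompass L Jx Jy) (Qop L q) = 0) (hjk : j + 2 ≤ k) {e : Bond L}
    (hq : q (mulSpec (bondSpec e)
      (mulSpec (bondSpec (branchBond b u (k - 2))) (chainSpec b u j (k - 1)))) ≠ 0) :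
    e = branchBond b u (k - 2) ∨ e = stairBond b u j ∨ e = stairBond b u (j + (k - 2)) := by
  set D := branchBond b u (k - 2) with hD
  set T := mulSpec (bondSpec D) (chainSpec b u j (k - 1)) with hT
  set A := mulSpec (bondSpec e) T with hA
  have hAv : ∀ v, A v = 0 → bondSpec e v = T v := fun v h => (letter_xor_eq_zero _ _).1 h
  have hbond : ∀ v, bondSpec e v ≠ 0 →
      bondSpec e v = ltr e.2 ∧ (v = e.1 ∨ v = e.1 + dir L e.2) := by
    intro v h
    rcases eq_or_eq_of_bondSpec_ne_zero h with rfl | rfl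
    · exact ⟨bondSpec_lo e, Or.inl rfl⟩
    · exact ⟨bondSpec_hi e, Or.inr rfl⟩
  have hTs : ∀ m < L, m ≠ k - 2 → T (stairSite b u m) = chainSpec b u j (k - 1) (stairSite b u m) := by
    intro m hm hm2
    rw [hT, mulSpec, bondSpec_branchBond (by omega) hm, if_neg hm2, letter_zero_xor]
  have hflj : stairFlag b (j + (k - 1)) = !stairFlag b (j + (k - 2)) := by
    rw [← stairFlag_succ]; congr 1; omega
  have hThi : T (stairSite b u (j + (k - 1))) = ltr (stairFlag b (j + (k - 2))) := by
    rw [hTs _ (by omega) (by omega), chainSpec_hi (by omega) (by omega), hflj, Bool.not_not]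
  have hTw : T (D.1 + dir L D.2) = ltr (!stairFlag b (k - 2)) := by
    rw [hT, mulSpec, bondSpec_hi, chainSpec_branchBond_hi (by omega) (by omega), letter_xor_zero]
    rfl
  have hbottom : A (stairSite b u j) = 0 → e = stairBond b u j := by
    intro h
    have h1 := hAv _ h
    by_cases hj2 : j = k - 2
    · have h2 : T (stairSite b u j) = 3 := by
        rw [hT, mulSpec, bondSpec_branchBond (by omega) (by omega), if_pos hj2,
          chainSpec_lo (by omega) (by omega), hj2]
        cases stairFlag b (k - 2) <;> decide
      obtain ⟨h3, -⟩ := hbond _ (by rw [h1, h2]; decide)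
      rw [h1, h2] at h3
      cases he : e.2 <;> rw [he] at h3 <;> exact absurd h3 (by decide)
    · rw [hTs j (by omega) hj2, chainSpec_lo (by omega) (by omega)] at h1
      obtain ⟨h3, h4⟩ := hbond _ (by rw [h1]; exact ltr_ne_zero _)
      have h5 := ltr_injective (h1.symm.trans h3)
      rcases h4 with h4 | h4
      · exact Prod.ext h4.symm h5.symm
      · exfalso
        have hl : lev e.1 + 1 = lev u + (j : ZMod L) := by
          rw [← lev_add_dir _ e.2, ← h4, lev_stairSite]
        have hT0 : T e.1 = 0 := by
          by_contra hT0
          obtain ⟨m, h6, h7, h8, -⟩ := lev_of_branch_ne_zero hjk hT0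
          rw [h8, add_assoc, ← Nat.cast_succ] at hl
          have := offset_inj (by omega) (by omega) hl
          omega
        have hA0 : A e.1 ≠ 0 := by
          rw [hA, mulSpec_bond_lo, hT0, letter_xor_zero]
          exact ltr_ne_zero _
        have hl2 : lev (stairSite b u (j + (k - 1))) = lev e.1 + (k : ZMod L) := by
          rw [← cast_pred_add_one hk, lev_stairSite, Nat.cast_add]
          linear_combination -hl
        have hA1 : A (stairSite b u (j + (k - 1))) ≠ 0 := by
          rw [hA, mulSpec_bond_of_ne, hThi]
          · exact ltr_ne_zero _
          · exact site_ne (a := lev e.1) k 0 hl2 (by simp) (by omega) (by omega) (by omega)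
          · rw [← h4, Ne, stairSite_inj (by omega) (by omega)]
            omega
        exact no_width_succ hkL hW hq hA0 hA1 hl2
  have htop : A (stairSite b u j) ≠ 0 → A (stairSite b u (j + (k - 1))) = 0 →
      e = stairBond b u (j + (k - 2)) := by
    intro h0 h
    have h1 := hAv _ h
    rw [hThi] at h1
    obtain ⟨h3, h4⟩ := hbond _ (by rw [h1]; exact ltr_ne_zero _)
    have h5 := ltr_injective (h1.symm.trans h3)
    rcases h4 with h4 | h4
    · exfalso
      have hl : lev (e.1 + dir L e.2) = lev u + ((j + k : ℕ) : ZMod L) := by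
        rw [lev_add_dir, ← h4, lev_stairSite, Nat.cast_add, Nat.cast_add, ← cast_pred_add_one hk]
        ring
      have hT0 : T (e.1 + dir L e.2) = 0 := by
        by_contra hT0
        obtain ⟨m, h6, h7, h8, -⟩ := lev_of_branch_ne_zero hjk hT0
        have := offset_inj (by omega) (by omega) (h8.symm.trans hl)
        omega
      have hA1 : A (e.1 + dir L e.2) ≠ 0 := by
        rw [hA, mulSpec_bond_hi, hT0, letter_xor_zero]
        exact ltr_ne_zero _
      exact no_width_succ hkL hW hq h0 hA1 (by rw [hl, lev_stairSite, Nat.cast_add, add_assoc])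
    · refine Prod.ext ?_ h5.symm
      rw [show j + (k - 1) = j + (k - 2) + 1 by omega, stairSite_succ, h5] at h4
      exact (add_right_cancel h4).symm
  by_cases hb0 : A (stairSite b u j) = 0
  · exact Or.inr (Or.inl (hbottom hb0))
  by_cases ht0 : A (stairSite b u (j + (k - 1))) = 0
  · exact Or.inr (Or.inr (htop hb0 ht0))
  refine Or.inl ?_
  have hfull : IsFull q k (lev u + (j : ZMod L)) A :=
    ⟨hq, ⟨_, lev_stairSite _ _ _, hb0⟩, _, by rw [lev_stairSite, Nat.cast_add, add_assoc], ht0⟩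
  obtain ⟨b', u', -, -, hlev, -⟩ := hfull.exists_stair hk hkL hW hJx hJy hcons (k - 1) le_rfl
  have huniq : ∀ m, j ≤ m → m < j + k → ∀ v v', lev v = lev u + (m : ZMod L) →
      lev v' = lev u + (m : ZMod L) → A v ≠ 0 → A v' ≠ 0 → v = v' := by
    intro m h1 h2 v v' hv hv' h3 h4
    have hm : lev u + (m : ZMod L) = lev u + (j : ZMod L) + ((m - j : ℕ) : ZMod L) := by
      rw [add_assoc, ← Nat.cast_add, Nat.add_sub_cancel' h1]
    rw [hm] at hv hv'
    exact ((hlev _ (by omega) v hv).1 h3).trans ((hlev _ (by omega) v' hv').1 h4).symm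
  have hwl : lev (D.1 + dir L D.2) = lev u + ((k - 1 : ℕ) : ZMod L) := by
    rw [hD, lev_branchBond_hi]; congr 2; omega
  have hp : A (stairSite b u (k - 1)) ≠ 0 := by
    rcases Nat.eq_zero_or_pos j with rfl | hj0
    · simpa using ht0
    intro h
    have h1 := hAv _ h
    rw [hTs _ (by omega) (by omega), chainSpec_interior (by omega) (by omega) (by omega)] at h1
    obtain ⟨h3, -⟩ := hbond _ (by rw [h1]; decide)
    rw [h1] at h3
    cases he : e.2 <;> rw [he] at h3 <;> exact absurd h3 (by decide)
  have hw : A (D.1 + dir L D.2) = 0 := by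
    by_contra hw
    exact branchBond_hi_ne (by omega) (by omega)
      (huniq (k - 1) (by omega) (by omega) _ _ hwl (lev_stairSite _ _ _) hw hp)
  have h1 := hAv _ hw
  rw [hTw] at h1
  obtain ⟨h3, h4⟩ := hbond _ (by rw [h1]; exact ltr_ne_zero _)
  have h5 := ltr_injective (h1.symm.trans h3)
  rcases h4 with h4 | h4
  · exfalso
    set y := e.1 + dir L e.2 with hy
    have hyl : lev y = lev u + (k : ZMod L) := by
      rw [hy, lev_add_dir, ← h4, hwl, add_assoc, cast_pred_add_one hk]
    have hpk : stairSite b u k = stairSite b u (k - 1) + dir L e.2 := by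
      rw [← h5, ← stairFlag_succ, show k - 2 + 1 = k - 1 by omega, ← stairSite_succ]
      congr 1; omega
    have hyp : y ≠ stairSite b u k := by
      rw [hy, hpk, ← h4]
      exact fun h => branchBond_hi_ne (by omega) (by omega) (add_right_cancel h)
    have hyw : y ≠ D.1 + dir L D.2 := site_ne _ _ hyl hwl (by omega) (by omega) (by omega)
    have hT0 : T y = 0 := by
      by_contra hT0
      obtain ⟨m, h6, h7, h8, h9⟩ := lev_of_branch_ne_zero hjk hT0
      obtain rfl := offset_inj (by omega) (by omega) (h8.symm.trans hyl)
      exact h9.elim hyw hyp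
    have hA1 : A y ≠ 0 := by
      rw [hA, mulSpec_bond_hi, hT0, letter_xor_zero]
      exact ltr_ne_zero _
    rcases Nat.eq_zero_or_pos j with rfl | hj0
    · obtain ⟨i, hi, hi2⟩ := hfull.exists_offset hk hkL hW hA1
      rw [Nat.cast_zero, add_zero, hyl] at hi2
      have := offset_inj (by omega) (by omega) hi2
      omega
    · refine hyp (huniq k (by omega) (by omega) _ _ hyl (lev_stairSite _ _ _) hA1 ?_)
      rw [hA, mulSpec_bond_of_ne, hTs _ (by omega) (by omega)]
      · rcases (show 1 ≤ j from hj0).eq_or_lt with rfl | hj1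
        · have := chainSpec_hi (b := b) (u := u) (j := 1) (n := k - 1) (by omega) (by omega)
          rw [show 1 + (k - 1) = k by omega] at this
          rw [this]
          exact ltr_ne_zero _
        · rw [chainSpec_interior (by omega) (by omega) (by omega)]
          decide
      · rw [← h4]
        exact (branchBond_hi_ne (by omega) (by omega)).symm
      · exact hyp.symm
  · refine Prod.ext ?_ h5.symm
    have : D.1 + dir L D.2 = e.1 + dir L D.2 := by
      rw [h4, ← h5]; rfl
    exact (add_right_cancel this).symm

end Branch

section Telescope

variable {L : ℕ} [NeZero L] {b : Bool} {u : Site L} {q : PSpec L → ℂ} {k : ℕ}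

theorem comm_branch_self (hL : 2 ≤ L) {D : Bond L} {C : Op L} {σ : PSpec L} (hC : IsPauli C σ)
    (h : BondAnti D σ) : bondOp D * (bondOp D * C) - bondOp D * C * bondOp D = (2 : ℂ) • C := by
  rw [← mul_assoc, bondOp_mul_self, one_mul, bondOp_mul_anticomm hL hC h, neg_mul, mul_assoc,
    bondOp_mul_self, mul_one, sub_neg_eq_add, two_smul]

open Classical in
theorem comm_branch_lo (hL : 2 ≤ L) {D e : Bond L} {C : Op L} {σ : PSpec L} (hC : IsPauli C σ)
    (h : BondAnti e σ) :
    bondOp e * (bondOp D * (bondOp e * C)) - bondOp D * (bondOp e * C) * bondOp e =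
      (if BondAnti e (bondSpec D) then (0 : ℂ) else 2) • (bondOp D * C) := by
  have h2 : bondOp D * (bondOp e * C) * bondOp e = -(bondOp D * C) := by
    rw [bondOp_mul_anticomm hL hC h, mul_neg, neg_mul, mul_assoc, mul_assoc, bondOp_mul_self,
      mul_one]
  rw [h2, ← mul_assoc]
  split_ifs with h3
  · rw [bondOp_mul_anticomm hL (isPauli_bondOp D) h3, neg_mul, mul_assoc, ← mul_assoc (bondOp e),
      bondOp_mul_self, one_mul, sub_self, zero_smul]
  · rw [bondOp_mul_comm hL (isPauli_bondOp D) h3, mul_assoc, ← mul_assoc (bondOp e),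
      bondOp_mul_self, one_mul, sub_neg_eq_add, two_smul]

open Classical in
theorem comm_branch_hi (hL : 2 ≤ L) {D e : Bond L} {C : Op L} {σ : PSpec L} (hC : IsPauli C σ)
    (h : BondAnti e σ) :
    bondOp e * (bondOp D * (C * bondOp e)) - bondOp D * (C * bondOp e) * bondOp e =
      -(if BondAnti e (bondSpec D) then (0 : ℂ) else 2) • (bondOp D * C) := by
  have h2 : bondOp D * (C * bondOp e) * bondOp e = bondOp D * C := by
    rw [mul_assoc, mul_assoc, bondOp_mul_self, mul_one]
  have h4 : bondOp e * (C * bondOp e) = -C := by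
    rw [← mul_assoc, bondOp_mul_anticomm hL hC h, neg_mul, mul_assoc, bondOp_mul_self, mul_one]
  rw [h2, ← mul_assoc]
  split_ifs with h3
  · rw [bondOp_mul_anticomm hL (isPauli_bondOp D) h3, neg_mul, mul_assoc, h4, mul_neg, neg_neg,
      sub_self, neg_zero, zero_smul]
  · rw [bondOp_mul_comm hL (isPauli_bondOp D) h3, mul_assoc, h4, mul_neg, neg_smul, two_smul]
    abel

/-- The contribution of the branched standard-form products with the `j`-th bond in front
removed. -/
noncomputable def branchTerm (q : PSpec L → ℂ) (Jx Jy : ℝ) (b : Bool) (u : Site L) (k j : ℕ) : ℂ :=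
  if j = 0 ∨ j + 1 = k then 0
  else coup Jx Jy (stairFlag b (j + 1)) *
    pairing L q (bondOp (branchBond b u (k - 2)) * chainOp b u j (k - 2))

theorem branch_equation (hk : 3 ≤ k) (hodd : k % 2 = 1) (hkL : 2 * k ≤ L)
    (hW : ∀ A, q A ≠ 0 → ∃ a, DiagBoundAt L A a k) {Jx Jy : ℝ} (hJx : Jx ≠ 0) (hJy : Jy ≠ 0)
    (hcons : opComm L (Hcompass L Jx Jy) (Qop L q) = 0) {j : ℕ} (hjk : j + 2 ≤ k) :
    coup Jx Jy (!stairFlag b (k - 2)) * pairing L q (chainOp b u j (k - 1)) +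
      (branchTerm q Jx Jy b u k (j + 1) - branchTerm q Jx Jy b u k j) = 0 := by
  have hL : 2 ≤ L := by omega
  have hM := (isPauli_bondOp (branchBond b u (k - 2))).mul (isPauli_chainOp b u j (k - 1))
  have hsum := sum_pairing_subset hL hcons hM
    {branchBond b u (k - 2), stairBond b u j, stairBond b u (j + (k - 2))}
    (fun e _ he => by
      simpa using mem_of_branch_ne_zero hk hkL hW hJx hJy hcons hjk he)
  have hne : stairBond b u j ≠ stairBond b u (j + (k - 2)) := fun h => by
    have := (stairSite_inj (by omega) (by omega)).1 (congrArg Prod.fst h)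
    omega
  rw [Finset.sum_insert (by
    simp only [Finset.mem_insert, Finset.mem_singleton, not_or]
    exact ⟨branchBond_ne_stairBond (by omega) (by omega),
      branchBond_ne_stairBond (by omega) (by omega)⟩), Finset.sum_pair hne,
    comm_branch_self hL (isPauli_chainOp b u j (k - 1))
      (bondAnti_branchBond_chain (by omega) (by omega) (by omega))] at hsum
  have e1 := comm_branch_lo (D := branchBond b u (k - 2)) hL (isPauli_chainOp b u (j + 1) (k - 2))
    (bondAnti_chain_lo (by omega) (by omega))
  have e2 := comm_branch_hi (D := branchBond b u (k - 2)) hL (isPauli_chainOp b u j (k - 2))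
    (bondAnti_chain_hi (by omega) (by omega))
  rw [← chainOp, show (k - 2).succ = k - 1 by omega] at e1
  rw [← chainOp_succ', show k - 2 + 1 = k - 1 by omega] at e2
  rw [e1, e2, pairing_smul, pairing_smul, pairing_smul] at hsum
  have hfl : stairFlag b (j + (k - 2)) = stairFlag b (j + 1) := by
    rw [show j + (k - 2) = j + 1 + 2 * ((k - 3) / 2) by omega, stairFlag_add_two_mul]
  have hfl2 : stairFlag b (j + 1 + 1) = stairFlag b j := by
    simpa using stairFlag_add_two_mul b j 1
  have d1 : BondAnti (stairBond b u j) (bondSpec (branchBond b u (k - 2))) ↔ j + 1 + 1 = k :=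
    (bondAnti_stairBond_branchBond (by omega) (by omega)).trans (by omega)
  have d2 : BondAnti (stairBond b u (j + (k - 2))) (bondSpec (branchBond b u (k - 2))) ↔ j = 0 :=
    (bondAnti_stairBond_branchBond (by omega) (by omega)).trans (by omega)
  simp only [d1, d2] at hsum
  have hj1 : j + 1 ≠ k := by omega
  simp only [branchTerm, hfl2, Nat.succ_ne_zero, false_or, hj1, or_false]
  simp only [branchBond, stairBond, hfl] at hsum ⊢
  refine mul_left_cancel₀ (two_ne_zero (α := ℂ)) ?_
  split_ifs at hsum ⊢ <;> linear_combination hsum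

theorem not_isFull (hk : 3 ≤ k) (hodd : k % 2 = 1) (hkL : 2 * k ≤ L)
    (hW : ∀ A, q A ≠ 0 → ∃ a, DiagBoundAt L A a k) {Jx Jy : ℝ} (hJx : Jx ≠ 0) (hJy : Jy ≠ 0)
    (hcons : opComm L (Hcompass L Jx Jy) (Qop L q) = 0) {a : ZMod L} {A : PSpec L} :
    ¬ IsFull q k a A := by
  intro hA
  obtain ⟨b, u, rfl⟩ := hA.eq_chain hk hkL hW hJx hJy hcons
  have hq := mt (isPauli_chainOp b u 0 (k - 1)).pairing_eq_zero_iff.1 hA.1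
  have hconst : ∀ j, j + 2 ≤ k →
      pairing L q (chainOp b u j (k - 1)) = pairing L q (chainOp b u 0 (k - 1)) := by
    intro j
    induction j with
    | zero => intro _; rfl
    | succ j ih =>
      intro hj
      have h := ih (by omega)
      rw [← h]
      refine pairing_chain_succ hk hodd hkL hW hJx hJy hcons (by omega) ?_
      exact mt (isPauli_chainOp b u j (k - 1)).pairing_eq_zero_iff.2 (by rwa [h])
  have hsum : ∑ j ∈ Finset.range (k - 1),
      (coup Jx Jy (!stairFlag b (k - 2)) * pairing L q (chainOp b u 0 (k - 1)) +
        (branchTerm q Jx Jy b u k (j + 1) - branchTerm q Jx Jy b u k j)) = 0 := by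
    refine Finset.sum_eq_zero fun j hj => ?_
    have hj := Finset.mem_range.1 hj
    rw [← hconst j (by omega)]
    exact branch_equation hk hodd hkL hW hJx hJy hcons (by omega)
  rw [Finset.sum_add_distrib, Finset.sum_range_sub, Finset.sum_const, Finset.card_range,
    nsmul_eq_mul] at hsum
  have h0 : branchTerm q Jx Jy b u k 0 = 0 := if_pos (Or.inl rfl)
  have h1 : branchTerm q Jx Jy b u k (k - 1) = 0 := if_pos (Or.inr (by omega))
  rw [h0, h1, sub_self, add_zero] at hsum
  refine mul_ne_zero ?_ (mul_ne_zero (coup_ne_zero hJx hJy _) hq) hsum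
  exact Nat.cast_ne_zero.2 (by omega)

end Telescope

theorem exists_diagBoundAt (L : ℕ) [NeZero L] (σ : PSpec L) : ∃ a, DiagBoundAt L σ a (Diag L σ) :=
  Nat.sInf_mem (s := {k | ∃ a : ZMod L, DiagBoundAt L σ a k}) ⟨L, 0, fun _ _ => ZMod.val_lt _⟩

/-- A Pauli product of diagonal length `k` meets both extreme levels of a bounding strip. -/
theorem isFull_of_diag_eq {L : ℕ} [NeZero L] {q : PSpec L → ℂ} {k : ℕ} (hk : 2 ≤ k)
    {σ : PSpec L} (hq : q σ ≠ 0) (hσ : Diag L σ = k) : ∃ a, IsFull q k a σ := by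
  obtain ⟨a, ha⟩ := exists_diagBoundAt L σ
  rw [hσ] at ha
  have hmin : ∀ a', ¬ DiagBoundAt L σ a' (k - 1) := fun a' h => by
    have : Diag L σ ≤ k - 1 := Nat.sInf_le ⟨a', h⟩
    omega
  have hval : ∀ v : Site L, lev v = a + (((v.1 + v.2 - a).val : ℕ) : ZMod L) := fun v => by
    rw [ZMod.natCast_zmod_val]
    simp [lev]
  refine ⟨a, hq, ?_, ?_⟩
  · by_contra h
    refine hmin (a + 1) fun v hv => ?_
    have h1 := ha v hv
    have h2 : v.1 + v.2 - a ≠ 0 := fun h0 => h ⟨v, sub_eq_zero.1 h0, hv⟩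
    have h3 : (v.1 + v.2 - a).val ≠ 0 := fun h0 => h2 ((ZMod.val_eq_zero _).1 h0)
    have h4 : v.1 + v.2 - (a + 1) = (((v.1 + v.2 - a).val - 1 : ℕ) : ZMod L) := by
      rw [Nat.cast_sub (by omega), ZMod.natCast_zmod_val]
      push_cast
      ring
    rw [h4, ZMod.val_natCast]
    exact (Nat.mod_le _ _).trans_lt (by omega)
  · by_contra h
    refine hmin a fun v hv => ?_
    have h1 := ha v hv
    have h2 : (v.1 + v.2 - a).val ≠ k - 1 := fun h0 => h ⟨v, by rw [hval v, h0], hv⟩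
    omega

theorem lev_stair {L : ℕ} (u1 : Site L) (j : ℕ) : lev (stair L u1 j) + 1 = lev u1 + (j : ZMod L) := by
  rw [stair]
  split_ifs with h
  · obtain ⟨m, rfl⟩ : ∃ m, j = 2 * m + 1 := ⟨j / 2, by omega⟩
    rw [show (2 * m + 1 - 1) / 2 = m by omega]
    simp only [lev, Prod.fst_add, Prod.snd_add]
    push_cast
    ring
  · obtain ⟨m, rfl⟩ : ∃ m, j = 2 * m := ⟨j / 2, by omega⟩
    rw [show 2 * m / 2 = m by omega]
    simp only [lev, Prod.fst_add, Prod.snd_add, Prod.fst_sub, Prod.snd_sub]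
    push_cast
    ring

theorem isFull_Cspec {L : ℕ} {q : PSpec L → ℂ} {k j : ℕ} {u1 : Site L} (hk : 1 ≤ k)
    (hq : q (Cspec L k j u1) ≠ 0) : IsFull q k (lev (stair L u1 j)) (Cspec L k j u1) := by
  have hL : endL j ≠ 0 := by rw [endL]; split_ifs <;> decide
  have hR : endR k j ≠ 0 := by rw [endR]; split_ifs <;> decide
  refine ⟨hq, ⟨stair L u1 j, rfl, by rwa [Cspec, if_pos rfl]⟩, stair L u1 (j + k - 1), ?_, ?_⟩
  · have h1 := lev_stair u1 j
    have h2 := lev_stair u1 (j + k - 1)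
    rw [Nat.add_sub_assoc hk, Nat.cast_add] at h2
    rw [Nat.add_sub_assoc hk]
    linear_combination h2 - h1
  · rw [Cspec]
    by_cases h : stair L u1 (j + k - 1) = stair L u1 j
    · rwa [if_pos h]
    · rwa [if_neg h, if_pos rfl]

/-- For odd `k̄` with `3 ≤ k̄ ≤ L/2`, all coefficients of the
standard-form products in a local conserved quantity vanish; consequently
`q_σ = 0` for every Pauli product with `Diag σ = k̄`, i.e. there is no local
conserved quantity with diagonal length `k̄`. -/
theorem no_local_conserved_quantity_odd_k
    (L : ℕ) [NeZero L] (Jx Jy : ℝ) (hJx : Jx ≠ 0) (hJy : Jy ≠ 0)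
    (k : ℕ) (hodd : k % 2 = 1) (hk : 3 ≤ k) (hkL : 2 * k ≤ L)
    (q : PSpec L → ℂ)
    (hsupp : ∀ σ : PSpec L, q σ ≠ 0 → σ ≠ 0 ∧ Diag L σ ≤ k)
    (hcons : opComm L (Hcompass L Jx Jy) (Qop L q) = 0) :
    (∀ (u1 : Site L) (j : ℕ), 1 ≤ j → q (Cspec L k j u1) = 0) ∧
    (∀ σ : PSpec L, Diag L σ = k → q σ = 0) := by
  have hW : ∀ A, q A ≠ 0 → ∃ a, DiagBoundAt L A a k := fun A hA => by
    obtain ⟨a, ha⟩ := exists_diagBoundAt L A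
    exact ⟨a, fun v hv => (ha v hv).trans_le (hsupp A hA).2⟩
  refine ⟨fun u1 j _ => ?_, fun σ hσ => ?_⟩
  · by_contra hq
    exact not_isFull hk hodd hkL hW hJx hJy hcons (isFull_Cspec (by omega) hq)
  · by_contra hq
    obtain ⟨a, ha⟩ := isFull_of_diag_eq (by omega) hq hσ
    exact not_isFull hk hodd hkL hW hJx hJy hcons ha
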